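/- Let q be an odd prime power, let G = GL_n(𝔽_q), and let A ∈ G be a matrix with A² = I. Let H = {X ∈ G : A X A⁻¹ = X} be the centralizer of A. If π is an irreducible finite-dimensional complex representation of G that has a nonzero H-invariant vector, then π is isomorphic to its dual representation π*. -/

import Mathlib

open Matrix

noncomputable section

namespace Paper

/-- nonzero vector invariant under a set of group elements -/
def HasInvVec {G V : Type*} [Group G] [AddCommGroup V] [Module ℂ V]
    (π : Representation ℂ G V) (S : Set G) : Prop :=
  ∃ v : V, v ≠ 0 ∧ ∀ g ∈ S, π g v = v

/-- nonzero invariant linear functional -/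
def HasInvFunctional {G V : Type*} [Group G] [AddCommGroup V] [Module ℂ V]
    (π : Representation ℂ G V) (S : Set G) : Prop :=
  ∃ ℓ : Module.Dual ℂ V, ℓ ≠ 0 ∧ ∀ g ∈ S, ∀ v : V, ℓ (π g v) = ℓ v

/-- isomorphism of representations -/
def RepIso {G V W : Type*} [Group G] [AddCommGroup V] [Module ℂ V] [AddCommGroup W] [Module ℂ W]
    (π : Representation ℂ G V) (π' : Representation ℂ G W) : Prop :=
  ∃ e : V ≃ₗ[ℂ] W, ∀ (g : G) (v : V), e (π g v) = π' g (e v)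

/-- irreducibility -/
def IsIrred {G V : Type*} [Group G] [AddCommGroup V] [Module ℂ V]
    (π : Representation ℂ G V) : Prop :=
  (∃ v : V, v ≠ 0) ∧
    ∀ W : Submodule ℂ V, (∀ (g : G), ∀ v ∈ W, π g v ∈ W) → W = ⊥ ∨ W = ⊤

/-- membership in the "unipotent radical" pattern for the partition function `f`:
the matrix agrees with the identity except at entries `(i,j)` with `f i < f j`. -/
def unipMem {F : Type*} [Field F] {n m : ℕ} (f : Fin n → Fin m)
    (A : Matrix (Fin n) (Fin n) F) : Prop :=
  ∀ i j, ¬ f i < f j → A i j = (1 : Matrix (Fin n) (Fin n) F) i j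

/-- a representation of `GL_n(F)` is cuspidal if for every proper standard parabolic
(given by a monotone surjection onto `Fin m`, `m ≥ 2`), the only vector invariant under the
corresponding unipotent radical is zero. -/
def IsCuspidal {F : Type*} [Field F] {n : ℕ} {V : Type*} [AddCommGroup V] [Module ℂ V]
    (π : Representation ℂ (GL (Fin n) F) V) : Prop :=
  ∀ (m : ℕ) (f : Fin n → Fin m), 2 ≤ m → Monotone f → Function.Surjective f →
    ∀ v : V, (∀ A : GL (Fin n) F, unipMem f (A : Matrix (Fin n) (Fin n) F) → π A v = v) → v = 0

/-- the standard parabolic subgroup attached to a partition function `f` (block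
upper-triangular invertible matrices). -/
def parabolic {F : Type*} [Field F] {n m : ℕ} (f : Fin n → Fin m) : Subgroup (GL (Fin n) F) where
  carrier := {A | BlockTriangular (A : Matrix (Fin n) (Fin n) F) f}
  one_mem' := by simpa using blockTriangular_one
  mul_mem' := fun ha hb => by simpa using Matrix.BlockTriangular.mul ha hb
  inv_mem' := by
    intro A hA
    have h : ((A⁻¹ : GL (Fin n) F) : Matrix (Fin n) (Fin n) F)
        = ((A : Matrix (Fin n) (Fin n) F))⁻¹ := by
      simp [Matrix.coe_units_inv]
    simp only [Set.mem_setOf_eq] at hA ⊢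
    rw [h]
    haveI : Invertible (A : Matrix (Fin n) (Fin n) F) := A.invertible
    exact blockTriangular_inv_of_blockTriangular hA


variable {F : Type*} [Field F] {n m k : ℕ}

def leviMem {α : Type*} (f : Fin n → α) (A : Matrix (Fin n) (Fin n) F) : Prop :=
  ∀ i j, f i ≠ f j → A i j = 0

/-- the standard Levi subgroup attached to a partition function `f`
(block-diagonal invertible matrices). -/
def levi (f : Fin n → Fin m) : Subgroup (GL (Fin n) F) where
  carrier := {A | leviMem f (A : Matrix (Fin n) (Fin n) F)}
  one_mem' := by
    intro i j hij
    have : i ≠ j := fun h => hij (by rw [h])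
    simp [Matrix.one_apply, this]
  mul_mem' := by
    intro A B hA hB
    intro i j hij
    show (((A : Matrix (Fin n) (Fin n) F)) * B) i j = 0
    rw [Matrix.mul_apply]
    apply Finset.sum_eq_zero
    intro x _
    by_cases h : f i = f x
    · rw [hB x j (by rw [← h]; exact hij), mul_zero]
    · rw [hA i x h, zero_mul]
  inv_mem' := by
    intro A hA
    simp only [Set.mem_setOf_eq] at hA ⊢
    haveI : Invertible (A : Matrix (Fin n) (Fin n) F) := A.invertible
    have h1 : BlockTriangular (A : Matrix (Fin n) (Fin n) F) f := fun i j h => hA i j (ne_of_gt h)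
    have h2 : BlockTriangular ((A : Matrix (Fin n) (Fin n) F))ᵀ f :=
      fun i j h => hA j i (ne_of_lt h)
    have h1' := blockTriangular_inv_of_blockTriangular h1
    haveI : Invertible ((A : Matrix (Fin n) (Fin n) F))ᵀ := Matrix.invertibleTranspose _
    have h2' := blockTriangular_inv_of_blockTriangular h2
    have hcoe : ((A⁻¹ : GL (Fin n) F) : Matrix (Fin n) (Fin n) F)
        = ((A : Matrix (Fin n) (Fin n) F))⁻¹ := by simp [Matrix.coe_units_inv]
    rw [hcoe]
    intro i j hij
    rcases lt_or_gt_of_ne hij with h | h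
    · have := h2' h
      rw [← Matrix.transpose_nonsing_inv] at this
      simpa using this
    · exact h1' h

theorem submatrix_mul_block (f : Fin n → Fin m) (a : Fin m) (e : Fin k → Fin n)
    (he : Function.Injective e) (hmem : ∀ i, f (e i) = a)
    (hsurj : ∀ j, f j = a → ∃ i, e i = j)
    {A B : Matrix (Fin n) (Fin n) F} (hA : BlockTriangular A f) (hB : BlockTriangular B f) :
    (A * B).submatrix e e = A.submatrix e e * B.submatrix e e := by
  ext i j
  rw [Matrix.submatrix_apply, Matrix.mul_apply, Matrix.mul_apply]
  rw [show (∑ x : Fin n, A (e i) x * B x (e j))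
      = ∑ x ∈ Finset.univ.image e, A (e i) x * B x (e j) from ?_]
  · rw [Finset.sum_image (fun x _ y _ h => he h)]
    simp
  · symm
    apply Finset.sum_subset (Finset.subset_univ _)
    intro x _ hx
    have hxa : f x ≠ a := by
      intro hfa
      obtain ⟨i', hi'⟩ := hsurj x hfa
      exact hx (Finset.mem_image.mpr ⟨i', Finset.mem_univ _, hi'⟩)
    rcases lt_or_gt_of_ne hxa with h | h
    · rw [hA (show f x < f (e i) by rw [hmem]; exact h), zero_mul]
    · rw [hB (show f (e j) < f x by rw [hmem]; exact h), mul_zero]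


theorem parabolic_mem' {F : Type*} [Field F] {n m : ℕ} {f : Fin n → Fin m} {A : GL (Fin n) F} :
    A ∈ parabolic f ↔ BlockTriangular (A : Matrix (Fin n) (Fin n) F) f := Iff.rfl

theorem levi_mem' {F : Type*} [Field F] {n m : ℕ} {f : Fin n → Fin m} {A : GL (Fin n) F} :
    A ∈ levi f ↔ leviMem f (A : Matrix (Fin n) (Fin n) F) := Iff.rfl

/-- extraction of the `a`-th diagonal block, as a group homomorphism from the parabolic
subgroup to a general linear group, along an enumeration `e` of the `a`-th block. -/
def leviProj (f : Fin n → Fin m) (a : Fin m) (e : Fin k → Fin n)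
    (he : Function.Injective e) (hmem : ∀ i, f (e i) = a)
    (hsurj : ∀ j, f j = a → ∃ i, e i = j) :
    (parabolic (F := F) f) →* GL (Fin k) F where
  toFun A :=
    { val := ((A : GL (Fin n) F) : Matrix (Fin n) (Fin n) F).submatrix e e
      inv := (((A : GL (Fin n) F)⁻¹ : GL (Fin n) F) : Matrix (Fin n) (Fin n) F).submatrix e e
      val_inv := by
        rw [← submatrix_mul_block f a e he hmem hsurj (parabolic_mem'.mp A.2)
          (parabolic_mem'.mp ((parabolic f).inv_mem A.2))]
        rw [show ((A : GL (Fin n) F) : Matrix (Fin n) (Fin n) F) *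
            (((A : GL (Fin n) F)⁻¹ : GL (Fin n) F) : Matrix (Fin n) (Fin n) F) = 1 by
          rw [← Units.val_mul, mul_inv_cancel, Units.val_one]]
        exact Matrix.submatrix_one e he
      inv_val := by
        rw [← submatrix_mul_block f a e he hmem hsurj
          (parabolic_mem'.mp ((parabolic f).inv_mem A.2)) (parabolic_mem'.mp A.2)]
        rw [show (((A : GL (Fin n) F)⁻¹ : GL (Fin n) F) : Matrix (Fin n) (Fin n) F) *
            ((A : GL (Fin n) F) : Matrix (Fin n) (Fin n) F) = 1 by
          rw [← Units.val_mul, inv_mul_cancel, Units.val_one]]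
        exact Matrix.submatrix_one e he }
  map_one' := by
    ext i j
    show ((1 : Matrix (Fin n) (Fin n) F).submatrix e e) i j = _
    rw [Matrix.submatrix_one e he]
    rfl
  map_mul' A B := by
    ext i j
    show ((((A * B : (parabolic f)) : GL (Fin n) F) : Matrix (Fin n) (Fin n) F).submatrix e e) i j
      = _
    rw [show (((A * B : (parabolic f)) : GL (Fin n) F) : Matrix (Fin n) (Fin n) F)
        = ((A : GL (Fin n) F) : Matrix (Fin n) (Fin n) F) *
          ((B : GL (Fin n) F) : Matrix (Fin n) (Fin n) F) from rfl]
    rw [submatrix_mul_block f a e he hmem hsurj (parabolic_mem'.mp A.2) (parabolic_mem'.mp B.2)]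
    rfl


open scoped TensorProduct

/-- exterior tensor product of representations: the product group `∀ a, G a` acts on
`⨂[ℂ] a, V a` factorwise. -/
def piTensorRep {ι : Type*} [Fintype ι] {G : ι → Type*} [∀ a, Group (G a)]
    {V : ι → Type*} [∀ a, AddCommGroup (V a)] [∀ a, Module ℂ (V a)]
    (π : ∀ a, Representation ℂ (G a) (V a)) :
    Representation ℂ (∀ a, G a) (⨂[ℂ] a, V a) :=
  PiTensorProduct.mapMonoidHom.comp
    { toFun := fun g => fun a => π a (g a)
      map_one' := by funext a; simp
      map_mul' := fun g h => by funext a; simp }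

variable {G : Type*} [Group G] {W : Type*} [AddCommGroup W] [Module ℂ W]

/-- the space of the induced representation (function model): functions `φ : G → W`
with `φ (p * g) = x p (φ g)`. -/
def IndCarrier (P : Subgroup G) (x : Representation ℂ P W) : Submodule ℂ (G → W) where
  carrier := {φ | ∀ (p : P) (g : G), φ (↑p * g) = x p (φ g)}
  add_mem' := by
    intro φ ψ hφ hψ p g
    simp only [Pi.add_apply, hφ p g, hψ p g, map_add]
  zero_mem' := by
    intro p g
    simp
  smul_mem' := by
    intro c φ hφ p g
    simp only [Pi.smul_apply, hφ p g, _root_.map_smul]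

/-- the induced representation `Ind_P^G x` in the function model, `(g • φ) y = φ (y * g)`. -/
def IndRep (P : Subgroup G) (x : Representation ℂ P W) :
    Representation ℂ G (IndCarrier P x) where
  toFun g :=
    { toFun := fun φ => ⟨fun y => (φ : G → W) (y * g), by
        intro p y
        show (φ : G → W) (↑p * y * g) = _
        rw [mul_assoc]
        exact φ.2 p (y * g)⟩
      map_add' := fun φ ψ => by ext y; rfl
      map_smul' := fun c φ => by ext y; rfl }
  map_one' := by
    apply LinearMap.ext
    intro φ
    apply Subtype.ext
    funext y
    show (φ : G → W) (y * 1) = (φ : G → W) y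
    rw [mul_one]
  map_mul' g h := by
    apply LinearMap.ext
    intro φ
    apply Subtype.ext
    funext y
    show (φ : G → W) (y * (g * h)) = (φ : G → W) (y * g * h)
    rw [mul_assoc]


theorem unip_conj {f : Fin n → Fin m} {l A : GL (Fin n) F}
    (hl : l ∈ levi f) (hA : unipMem f (A : Matrix (Fin n) (Fin n) F)) :
    unipMem f ((l⁻¹ * A * l : GL (Fin n) F) : Matrix (Fin n) (Fin n) F) := by
  have hli : leviMem f ((l⁻¹ : GL (Fin n) F) : Matrix (Fin n) (Fin n) F) :=
    levi_mem'.mp ((levi f).inv_mem hl)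
  have hlm : leviMem f ((l : GL (Fin n) F) : Matrix (Fin n) (Fin n) F) := levi_mem'.mp hl
  set li := ((l⁻¹ : GL (Fin n) F) : Matrix (Fin n) (Fin n) F) with hli_def
  set lm := ((l : GL (Fin n) F) : Matrix (Fin n) (Fin n) F) with hlm_def
  set Am := ((A : GL (Fin n) F) : Matrix (Fin n) (Fin n) F) with hAm_def
  have hval : ((l⁻¹ * A * l : GL (Fin n) F) : Matrix (Fin n) (Fin n) F) = li * Am * lm := by
    rw [Units.val_mul, Units.val_mul]
  have hN : li * Am * lm = 1 + li * (Am - 1) * lm := by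
    have h1 : li * lm = 1 := by
      rw [hli_def, hlm_def, ← Units.val_mul, inv_mul_cancel, Units.val_one]
    rw [Matrix.mul_sub, Matrix.mul_one, Matrix.sub_mul, h1]
    abel
  intro i j hij
  rw [hval, hN, Matrix.add_apply]
  have hzero : (li * (Am - 1) * lm) i j = 0 := by
    rw [Matrix.mul_apply]
    apply Finset.sum_eq_zero
    intro t _
    by_cases ht : f t = f j
    · rw [Matrix.mul_apply]
      have : ∀ s ∈ Finset.univ, li i s * (Am - 1) s t = 0 := by
        intro s _
        by_cases hs : f i = f s
        · have hN0 : (Am - 1) s t = 0 := by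
            have : ¬ f s < f t := by rw [← hs, ht]; exact hij
            rw [Matrix.sub_apply, hA s t this, sub_self]
          rw [hN0, mul_zero]
        · rw [hli i s (fun h => hs h), zero_mul]
      rw [Finset.sum_eq_zero this, zero_mul]
    · rw [hlm t j ht, mul_zero]
  rw [hzero, add_zero]

variable {V : Type*} [AddCommGroup V] [Module ℂ V]

/-- the Jacquet restriction: the space of vectors invariant under the unipotent radical. -/
def jacquetModule (π : Representation ℂ (GL (Fin n) F) V) (f : Fin n → Fin m) :
    Submodule ℂ V where
  carrier := {v | ∀ A : GL (Fin n) F, unipMem f (A : Matrix (Fin n) (Fin n) F) → π A v = v}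
  add_mem' := fun hv hw A hA => by rw [map_add, hv A hA, hw A hA]
  zero_mem' := fun A hA => by simp
  smul_mem' := fun c v hv A hA => by rw [_root_.map_smul, hv A hA]

theorem jacquet_stable (π : Representation ℂ (GL (Fin n) F) V) (f : Fin n → Fin m)
    {l : GL (Fin n) F} (hl : l ∈ levi f) {v : V} (hv : v ∈ jacquetModule π f) :
    π l v ∈ jacquetModule π f := by
  intro A hA
  have key : A * l = l * (l⁻¹ * A * l) := by group
  have : π A (π l v) = π (A * l) v := by rw [_root_.map_mul]; rfl
  rw [this, key, _root_.map_mul]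
  have : π (l⁻¹ * A * l) v = v := hv _ (unip_conj hl hA)
  show π l (π (l⁻¹ * A * l) v) = π l v
  rw [this]

/-- the Jacquet restriction of `π` as a representation of the Levi subgroup. -/
def jacquetRep (π : Representation ℂ (GL (Fin n) F) V) (f : Fin n → Fin m) :
    Representation ℂ (levi (F := F) f) (jacquetModule π f) where
  toFun l := (π (l : GL (Fin n) F)).restrict (fun v hv => jacquet_stable π f l.2 hv)
  map_one' := by
    apply LinearMap.ext
    intro v
    apply Subtype.ext
    show π ((1 : levi (F := F) f) : GL (Fin n) F) (v : V) = (v : V)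
    rw [Subgroup.coe_one, _root_.map_one]
    rfl
  map_mul' l l' := by
    apply LinearMap.ext
    intro v
    apply Subtype.ext
    show π (((l * l' : levi (F := F) f)) : GL (Fin n) F) (v : V) = _
    rw [Subgroup.coe_mul, _root_.map_mul]
    rfl



section ParabolicInduction

variable {F : Type*} [Field F]

/-- the group homomorphism from a parabolic subgroup onto the product of the general linear
groups of its diagonal blocks. -/
def leviProjPi {N m : ℕ} (f : Fin N → Fin m) {k : Fin m → ℕ} (e : ∀ a, Fin (k a) → Fin N)
    (he : ∀ a, Function.Injective (e a)) (hmem : ∀ a i, f (e a i) = a)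
    (hsurj : ∀ a j, f j = a → ∃ i, e a i = j) :
    (parabolic (F := F) f) →* (∀ a, GL (Fin (k a)) F) :=
  Pi.monoidHom (fun a => leviProj f a (e a) (he a) (hmem a) (hsurj a))

/-- parabolic induction: the representation of `GL_N(F)` induced from the inflation to the
parabolic subgroup attached to `f` of the exterior tensor product of the `π a`. -/
def parabolicInd {N m : ℕ} (f : Fin N → Fin m) {k : Fin m → ℕ} (e : ∀ a, Fin (k a) → Fin N)
    (he : ∀ a, Function.Injective (e a)) (hmem : ∀ a i, f (e a i) = a)
    (hsurj : ∀ a j, f j = a → ∃ i, e a i = j)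
    {V : Fin m → Type*} [∀ a, AddCommGroup (V a)] [∀ a, Module ℂ (V a)]
    (π : ∀ a, Representation ℂ (GL (Fin (k a)) F) (V a)) :
    Representation ℂ (GL (Fin N) F)
      (IndCarrier (parabolic f) ((piTensorRep π).comp (leviProjPi f e he hmem hsurj))) :=
  IndRep (parabolic f) ((piTensorRep π).comp (leviProjPi f e he hmem hsurj))

end ParabolicInduction

/-- `A` is a monomial matrix (normalizes the diagonal torus) with underlying
permutation `σ`. -/
def IsMonomialWith {F : Type*} [Field F] {n : ℕ} (A : GL (Fin n) F)
    (σ : Equiv.Perm (Fin n)) : Prop :=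
  ∀ i j, i ≠ σ j → (A : Matrix (Fin n) (Fin n) F) i j = 0

/-- the space of equivariant linear maps between two representations. -/
def equivariantMaps {G V W : Type*} [Group G] [AddCommGroup V] [Module ℂ V]
    [AddCommGroup W] [Module ℂ W]
    (π : Representation ℂ G V) (π' : Representation ℂ G W) : Submodule ℂ (V →ₗ[ℂ] W) where
  carrier := {T | ∀ (g : G) (v : V), T (π g v) = π' g (T v)}
  add_mem' := by
    intro T S hT hS g v
    simp [hT g v, hS g v]
  zero_mem' := by intro g v; simp
  smul_mem' := by
    intro c T hT g v
    simp [hT g v]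

/-- a representation is self-dual -/
def SelfDual {G V : Type*} [Group G] [AddCommGroup V] [Module ℂ V]
    (π : Representation ℂ G V) : Prop :=
  RepIso π π.dual

/-- A hyperplane of a vector space. -/
def IsHyp {F V : Type*} [Field F] [AddCommGroup V] [Module F V] (U : Submodule F V) : Prop :=
  (∃ v, v ∉ U) ∧ ∀ v, v ∉ U → ∀ x, ∃ c : F, x - c • v ∈ U

section Hyperplanes

variable {F V V' : Type*} [Field F] [AddCommGroup V] [Module F V] [AddCommGroup V'] [Module F V']

theorem IsHyp.isCompl {U : Submodule F V} (hU : IsHyp U) {v : V} (hv : v ∉ U) :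
    IsCompl U (F ∙ v) := by
  constructor
  · rw [Submodule.disjoint_def]
    intro x hx hxv
    obtain ⟨c, rfl⟩ := Submodule.mem_span_singleton.1 hxv
    by_cases hc : c = 0
    · simp [hc]
    · exact absurd ((Submodule.smul_mem_iff U hc).1 hx) hv
  · rw [codisjoint_iff, eq_top_iff]
    intro x _
    obtain ⟨c, hc⟩ := hU.2 v hv x
    have : x = (x - c • v) + c • v := by abel
    rw [this]
    exact Submodule.add_mem_sup hc (Submodule.smul_mem _ _ (Submodule.mem_span_singleton_self v))

theorem IsHyp.exists_glue {U : Submodule F V} (hU : IsHyp U) {v v' : V} (hv : v ∉ U)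
    (hv' : v' ∉ U) (g : U ≃ₗ[F] U) :
    ∃ G : V ≃ₗ[F] V, (∀ u : U, G u = g u) ∧ G v = v' := by
  have h0 : v ≠ 0 := fun h => hv (h ▸ U.zero_mem)
  have h0' : v' ≠ 0 := fun h => hv' (h ▸ U.zero_mem)
  let e := Submodule.prodEquivOfIsCompl U (F ∙ v) (hU.isCompl hv)
  let e' := Submodule.prodEquivOfIsCompl U (F ∙ v') (hU.isCompl hv')
  let s := (LinearEquiv.toSpanNonzeroSingleton F V v h0).symm ≪≫ₗ
    LinearEquiv.toSpanNonzeroSingleton F V v' h0'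
  have hs : s ⟨v, Submodule.mem_span_singleton_self v⟩ =
      ⟨v', Submodule.mem_span_singleton_self v'⟩ := by
    have h1 : (LinearEquiv.toSpanNonzeroSingleton F V v h0) 1 =
      ⟨v, Submodule.mem_span_singleton_self v⟩ := LinearEquiv.toSpanNonzeroSingleton_one F V v h0
    simp only [s, ← h1, LinearEquiv.trans_apply, LinearEquiv.symm_apply_apply]
    exact LinearEquiv.toSpanNonzeroSingleton_one F V v' h0'
  refine ⟨e.symm ≪≫ₗ (g.prodCongr s) ≪≫ₗ e', fun u => ?_, ?_⟩
  · have : (u : V) = e (u, 0) := by simp [e]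
    rw [this]
    simp [e']
  · have h : e.symm v = (0, ⟨v, Submodule.mem_span_singleton_self v⟩) := by
      rw [LinearEquiv.symm_apply_eq]
      simp [e]
    simp only [LinearEquiv.trans_apply, h, LinearEquiv.prodCongr_apply, hs, map_zero]
    simp [e']

theorem IsHyp.eq_of_le {U W : Submodule F V} (hU : IsHyp U) (hW : IsHyp W) (h : U ≤ W) :
    U = W := by
  by_contra hne
  obtain ⟨w, hw, hwU⟩ := SetLike.exists_of_lt (lt_of_le_of_ne h hne)
  obtain ⟨v, hv⟩ := hW.1
  obtain ⟨c, hc⟩ := hU.2 w hwU v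
  exact hv (by simpa using W.add_mem (h hc) (W.smul_mem c hw))

theorem IsHyp.comap_subtype {U W : Submodule F V} (hW : IsHyp W) (h : ¬ U ≤ W) :
    IsHyp (W.comap U.subtype) := by
  obtain ⟨u, hu, huW⟩ := SetLike.not_le_iff_exists.1 h
  refine ⟨⟨⟨u, hu⟩, huW⟩, fun v hv x => ?_⟩
  obtain ⟨c, hc⟩ := hW.2 v hv x
  exact ⟨c, by simpa using hc⟩

theorem IsHyp.comap_equiv {U : Submodule F V} (hU : IsHyp U) (e : V' ≃ₗ[F] V) :
    IsHyp (U.comap (e : V' →ₗ[F] V)) := by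
  obtain ⟨v, hv⟩ := hU.1
  refine ⟨⟨e.symm v, by simpa using hv⟩, fun w hw x => ?_⟩
  obtain ⟨c, hc⟩ := hU.2 (e w) hw (e x)
  exact ⟨c, by simpa using hc⟩

theorem IsHyp.finrank_lt [FiniteDimensional F V] {U : Submodule F V} (hU : IsHyp U) :
    Module.finrank F U < Module.finrank F V := by
  apply Submodule.finrank_lt
  rintro rfl
  obtain ⟨v, hv⟩ := hU.1
  exact hv trivial

theorem isHyp_ker {φ : Module.Dual F V} (hφ : φ ≠ 0) : IsHyp (LinearMap.ker φ) := by
  constructor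
  · by_contra! h
    exact hφ (LinearMap.ext h)
  · intro v hv x
    have hv' : φ v ≠ 0 := hv
    exact ⟨φ x / φ v, by simp [hv']⟩

theorem exists_extend_injective [FiniteDimensional F V] {U : Submodule F V} (f : U →ₗ[F] V)
    (hf : Function.Injective f) : ∃ g : V ≃ₗ[F] V, ∀ u : U, g u = f u := by
  obtain ⟨C, hC⟩ := U.exists_isCompl
  obtain ⟨D, hD⟩ := (LinearMap.range f).exists_isCompl
  have hrank : Module.finrank F C = Module.finrank F D := by
    have h1 := Submodule.finrank_add_eq_of_isCompl hC
    have h2 := Submodule.finrank_add_eq_of_isCompl hD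
    rw [LinearMap.finrank_range_of_inj hf] at h2
    omega
  refine ⟨(Submodule.prodEquivOfIsCompl U C hC).symm ≪≫ₗ
    ((LinearEquiv.ofInjective f hf).prodCongr (LinearEquiv.ofFinrankEq C D hrank)) ≪≫ₗ
    Submodule.prodEquivOfIsCompl _ D hD, fun u => ?_⟩
  have h : (Submodule.prodEquivOfIsCompl U C hC).symm u = (u, 0) := by
    rw [LinearEquiv.symm_apply_eq]
    simp
  simp only [LinearEquiv.trans_apply, h, LinearEquiv.prodCongr_apply]
  simp

end Hyperplanes

/-- Subsets of the automorphism groups of vector spaces that contain the group of automorphisms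
preserving a chain of successive hyperplanes and commuting, on the last one, with an involution. -/
inductive Flagged (F : Type) [Field F] :
    ∀ (V : Type) [AddCommGroup V] [Module F V], Set (V ≃ₗ[F] V) → Prop
  | base (V : Type) [AddCommGroup V] [Module F V] (A : V →ₗ[F] V) (hA : ∀ v, A (A v) = v)
      (J : Set (V ≃ₗ[F] V)) (h : ∀ g : V ≃ₗ[F] V, (∀ v, g (A v) = A (g v)) → g ∈ J) : Flagged F V J
  | step (V : Type) [AddCommGroup V] [Module F V] (W : Submodule F V) (hW : IsHyp W)
      (JW : Set (W ≃ₗ[F] W)) (hJW : Flagged F W JW) (J : Set (V ≃ₗ[F] V))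
      (h : ∀ g : V ≃ₗ[F] V, ∀ g' ∈ JW, (∀ w : W, g w = g' w) → g ∈ J) : Flagged F V J

section Flagged

variable {F : Type} [Field F]

theorem Flagged.mono {V : Type} [AddCommGroup V] [Module F V] {J J' : Set (V ≃ₗ[F] V)}
    (h : Flagged F V J) (hJ : J ⊆ J') : Flagged F V J' := by
  cases h with
  | base _ A hA _ h => exact .base V A hA _ fun g hg => hJ (h g hg)
  | step _ W hW JW hJW _ h => exact .step V W hW JW hJW _ fun g g' hg' hw => hJ (h g g' hg' hw)

theorem Flagged.transport {V : Type} [AddCommGroup V] [Module F V] {J : Set (V ≃ₗ[F] V)}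
    (h : Flagged F V J) : ∀ {V' : Type} [AddCommGroup V'] [Module F V'] (e : V' ≃ₗ[F] V),
      Flagged F V' {g | e.symm ≪≫ₗ g ≪≫ₗ e ∈ J} := by
  induction h with
  | base V A hA J h =>
    intro V' _ _ e
    refine .base V' (e.symm.toLinearMap ∘ₗ A ∘ₗ e.toLinearMap) (by simp [hA]) _ fun g hg => ?_
    refine h _ fun v => ?_
    have := hg (e.symm v)
    simp at this
    simp [this]
  | step V W hW JW hJW J h ih =>
    intro V' _ _ e
    let eW : W.comap (e : V' →ₗ[F] V) ≃ₗ[F] W := e.ofSubmodule' W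
    refine .step V' _ (hW.comap_equiv e) _ (ih eW) _ fun g g' hg' hw => ?_
    refine h _ _ hg' fun w => ?_
    have h1 : ((eW.symm w : W.comap (e : V' →ₗ[F] V)) : V') = e.symm w := by
      apply e.injective
      have : eW (eW.symm w) = w := by simp
      rw [e.apply_symm_apply]
      exact congrArg Subtype.val this
    have := hw (eW.symm w)
    rw [h1] at this
    simp only [LinearEquiv.trans_apply, this]
    rfl

/-- The intersection of two submodules, seen inside each of them. -/
def interEquiv {V : Type} [AddCommGroup V] [Module F V] (U W : Submodule F V) :
    W.comap U.subtype ≃ₗ[F] U.comap W.subtype where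
  toFun x := ⟨⟨x, x.2⟩, x.1.2⟩
  invFun x := ⟨⟨x, x.2⟩, x.1.2⟩
  map_add' _ _ := rfl
  map_smul' _ _ := rfl
  left_inv _ := rfl
  right_inv _ := rfl

theorem Flagged.restrict (h2 : (2 : F) ≠ 0) {V : Type} [AddCommGroup V] [Module F V]
    {J : Set (V ≃ₗ[F] V)} (h : Flagged F V J) : ∀ {U : Submodule F V}, IsHyp U →
      Flagged F U {g' | ∃ g ∈ J, ∀ u : U, g u = g' u} := by
  induction h with
  | base V A hA J h =>
    intro U hU
    by_cases hAU : ∀ u ∈ U, A u ∈ U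
    · refine .base U (A.restrict hAU) (fun v => Subtype.ext (hA v)) _ fun g' hg' => ?_
      obtain ⟨w, hw, c, hc⟩ : ∃ w, w ∉ U ∧ ∃ c : F, A w = c • w := by
        obtain ⟨v, hv⟩ := hU.1
        by_cases hp : v + A v ∈ U
        · refine ⟨v - A v, fun hm => hv ?_, -1, by simp [hA]⟩
          have h3 := U.add_mem hp hm
          have h4 : v + A v + (v - A v) = (2 : F) • v := by rw [two_smul]; abel
          rw [h4] at h3
          exact (U.smul_mem_iff h2).1 h3
        · exact ⟨v + A v, hp, 1, by simp [hA, add_comm]⟩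
      obtain ⟨g, hg, hgw⟩ := hU.exists_glue hw hw g'
      refine ⟨g, h g fun v => ?_, hg⟩
      obtain ⟨d, hd⟩ := hU.2 w hw v
      have h5 : v = (⟨_, hd⟩ : U) + d • w := by simp
      generalize (⟨_, hd⟩ : U) = u at h5
      have h6 : A u = (A.restrict hAU u : U) := rfl
      have h7 : A (g' u : U) = (A.restrict hAU (g' u) : U) := rfl
      rw [h5]
      simp only [map_add, map_smul, hgw, hc, hg, h7, h6, hg' u]
    · push Not at hAU
      obtain ⟨t, ht, hAt⟩ := hAU
      let e := LinearEquiv.ofInvolutive A hA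
      have hW : IsHyp (Submodule.comap U.subtype (U.comap A)) :=
        (hU.comap_equiv e).comap_subtype fun hle => hAt (hle ht)
      let AW : Submodule.comap U.subtype (U.comap A) →ₗ[F]
          Submodule.comap U.subtype (U.comap A) :=
        { toFun x := ⟨⟨A x, x.2⟩, show A (A x) ∈ U by rw [hA]; exact x.1.2⟩
          map_add' x y := by ext; simp
          map_smul' c x := by ext; simp }
      refine .step U _ hW _ (.base _ AW (fun v => Subtype.ext (Subtype.ext (hA v))) _
        fun g hg => hg) _ fun g'' g' hg' hext => ?_
      have hgt : A (g'' ⟨t, ht⟩) ∉ U := by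
        intro hmem
        let w : Submodule.comap U.subtype (U.comap A) := ⟨g'' ⟨t, ht⟩, hmem⟩
        have h3 := hext (g'.symm w)
        rw [g'.apply_symm_apply, g''.injective.eq_iff] at h3
        exact hAt (by simpa [h3] using (g'.symm w).2)
      obtain ⟨g, hg, hgw⟩ := hU.exists_glue hAt hgt g''
      refine ⟨g, h g fun v => ?_, hg⟩
      obtain ⟨c, hc⟩ := hU.2 _ hAt v
      obtain ⟨d, hd⟩ := hW.2 ⟨t, ht⟩ hAt ⟨_, hc⟩
      have h5 : v = ((⟨_, hd⟩ : Submodule.comap U.subtype (U.comap A)) : U) +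
        d • ((⟨t, ht⟩ : U) : V) + c • A t := by simp
      generalize (⟨_, hd⟩ : Submodule.comap U.subtype (U.comap A)) = w at h5
      have h6 : A (w : U) = (AW w : U) := rfl
      have h7 : A (g' w : U) = (AW (g' w) : U) := rfl
      have h8 : g t = (g'' ⟨t, ht⟩ : U) := hg ⟨t, ht⟩
      rw [h5]
      simp only [map_add, map_smul, hgw, hg, hA, h6, hext, h7, h8]
      rw [show g' (AW w) = AW (g' w) from hg' w]
  | step V W hW JW hJW J h ih =>
    intro U hU
    by_cases hUW : U = W
    · subst hUW
      refine hJW.mono fun g' hg' => ?_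
      obtain ⟨v, hv⟩ := hU.1
      obtain ⟨g, hg, -⟩ := hU.exists_glue hv hv g'
      exact ⟨g, h g g' hg' hg, hg⟩
    · have hUW' : ¬ U ≤ W := fun hle => hUW (hU.eq_of_le hW hle)
      have hWU : ¬ W ≤ U := fun hle => hUW (hW.eq_of_le hU hle).symm
      have hI : IsHyp (U.comap W.subtype) := hU.comap_subtype hWU
      refine .step U _ (hW.comap_subtype hUW') _ ((ih hI).transport (interEquiv U W)) _ ?_
      rintro g'' g' ⟨gW, hgW, hgW'⟩ hext
      obtain ⟨v, hvW, hvU⟩ := SetLike.not_le_iff_exists.1 hWU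
      have hx : ∀ x : V, ∀ hU : x ∈ U, ∀ hxW : x ∈ W,
          ((gW ⟨x, hxW⟩ : W) : V) = g'' ⟨x, hU⟩ := by
        intro x hxU hxW
        rw [hgW' ⟨⟨x, hxW⟩, hxU⟩, hext ⟨⟨x, hxU⟩, hxW⟩]
        rfl
      have hv' : ((gW ⟨v, hvW⟩ : W) : V) ∉ U := by
        intro hmem
        let y : W.comap U.subtype := ⟨⟨_, hmem⟩, (gW ⟨v, hvW⟩).2⟩
        have h3 := hext (g'.symm y)
        rw [g'.apply_symm_apply] at h3
        have h4 := hx (g'.symm y) (g'.symm y).1.2 (g'.symm y).2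
        have h5 : gW ⟨g'.symm y, (g'.symm y).2⟩ = gW ⟨v, hvW⟩ :=
          Subtype.ext (h4.trans (congrArg Subtype.val h3))
        have h6 : ((g'.symm y : U) : V) = v := congrArg Subtype.val (gW.injective h5)
        exact hvU (h6 ▸ (g'.symm y).1.2)
      obtain ⟨g, hg, hgv⟩ := hU.exists_glue hvU hv' g''
      refine ⟨g, h g gW hgW fun w => ?_, hg⟩
      obtain ⟨c, hc⟩ := hI.2 ⟨v, hvW⟩ hvU w
      obtain ⟨w0, hw0, rfl⟩ : ∃ w0 : W, (w0 : V) ∈ U ∧ w = w0 + c • ⟨v, hvW⟩ :=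
        ⟨w - c • (⟨v, hvW⟩ : W), hc, by abel⟩
      clear hc
      rw [map_add, Submodule.coe_add, Submodule.coe_add, map_add]
      congr 1
      · exact (hg ⟨_, hw0⟩).trans (hx w0 hw0 w0.2).symm
      · rw [map_smul]
        simp [hgv]

end Flagged

section Theta

variable {F V : Type} [Field F] [AddCommGroup V] [Module F V]

/-- The logarithmic trace of an automorphism `w` commuting with `ν`, where `k` is a contracting
homotopy for `ν` and `w'` is the inverse of `w`. -/
def theta (ν k w w' : Module.End F V) : F :=
  LinearMap.trace F V (ν * k * (w * k * w' - k))

variable {ν k : Module.End F V}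

theorem trace_mul_eq_zero (hν : ν * ν = 0) (hk : ν * k + k * ν = 1) {M : Module.End F V}
    (hM : ν * M = M * ν) : LinearMap.trace F V (ν * M) = 0 := by
  have h1 : ν * M = M * ν * ν * k + ν * M * k * ν := by
    calc ν * M = ν * M * (ν * k + k * ν) := by rw [hk, mul_one]
      _ = ν * M * ν * k + ν * M * k * ν := by noncomm_ring
      _ = _ := by rw [hM]
  rw [h1, map_add, LinearMap.trace_mul_comm F (ν * M * k) ν, mul_assoc M, hν,
    show ν * (ν * M * k) = ν * ν * (M * k) by noncomm_ring, hν]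
  simp

theorem trace_mul_mul_eq_zero [FiniteDimensional F V] (hν : ν * ν = 0) (hk : ν * k + k * ν = 1)
    {c d : Module.End F V} (hc : ν * c + c * ν = 0) (hd : ν * d + d * ν = 0) :
    LinearMap.trace F V (ν * c * d) = 0 := by
  rw [mul_assoc]
  refine trace_mul_eq_zero hν hk ?_
  have h1 : ν * (c * d) - c * d * ν = (ν * c + c * ν) * d - c * (ν * d + d * ν) := by noncomm_ring
  rw [hc, hd] at h1
  simpa [sub_eq_zero] using h1

theorem anticomm_conj (hk : ν * k + k * ν = 1) {w w' : Module.End F V} (hw : w * w' = 1)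
    (hν : ν * w = w * ν) (hν' : ν * w' = w' * ν) :
    ν * (w * k * w' - k) + (w * k * w' - k) * ν = 0 := by
  have h1 : ν * (w * k * w' - k) + (w * k * w' - k) * ν =
      (ν * w - w * ν) * k * w' - w * k * (ν * w' - w' * ν)
        + w * (ν * k + k * ν) * w' - (ν * k + k * ν) := by noncomm_ring
  rw [h1, hν, hν', hk]
  simp [hw]

theorem commute_inv [FiniteDimensional F V] {w w' : Module.End F V} (hw : w * w' = 1)
    (hν : ν * w = w * ν) :
    ν * w' = w' * ν := by
  have hw' : w' * w = 1 := mul_eq_one_comm.1 hw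
  calc ν * w' = w' * w * ν * w' := by rw [hw', one_mul]
    _ = w' * (ν * w) * w' := by rw [hν]; noncomm_ring
    _ = w' * ν * (w * w') := by noncomm_ring
    _ = _ := by rw [hw, mul_one]

theorem trace_conj_anticomm [FiniteDimensional F V] (hν : ν * ν = 0) (hk : ν * k + k * ν = 1)
    {d w w' : Module.End F V}
    (hd : ν * d + d * ν = 0) (hw : w * w' = 1) (hw1 : ν * w = w * ν) :
    LinearMap.trace F V (ν * k * (w * d * w')) = LinearMap.trace F V (ν * k * d) := by
  have hw' : w' * w = 1 := mul_eq_one_comm.1 hw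
  have hw2 := commute_inv hw hw1
  have h1 : LinearMap.trace F V (ν * k * (w * d * w')) =
      LinearMap.trace F V (ν * (w' * k * w - k) * d) + LinearMap.trace F V (ν * k * d) := by
    rw [← map_add, show ν * k * (w * d * w') = ν * k * w * d * w' by noncomm_ring,
      LinearMap.trace_mul_comm]
    congr 1
    calc w' * (ν * k * w * d) = (w' * ν) * k * w * d := by noncomm_ring
      _ = (ν * w') * k * w * d := by rw [hw2]
      _ = _ := by noncomm_ring
  rw [h1, trace_mul_mul_eq_zero hν hk (anticomm_conj hk hw' hw2 hw1) hd, zero_add]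

theorem theta_indep [FiniteDimensional F V] (hν : ν * ν = 0) (hk : ν * k + k * ν = 1)
    {l : Module.End F V}
    (hl : ν * l + l * ν = 1) {w w' : Module.End F V} (hw : w * w' = 1) (hw1 : ν * w = w * ν) :
    theta ν k w w' = theta ν l w w' := by
  have hw2 := commute_inv hw hw1
  have hd : ν * (k - l) + (k - l) * ν = 0 := by
    calc _ = ν * k + k * ν - (ν * l + l * ν) := by noncomm_ring
      _ = 0 := by rw [hk, hl, sub_self]
  have h1 : ν * k * (w * k * w' - k) = ν * l * (w * l * w' - l)
      + ν * (k - l) * (w * k * w' - k) + (ν * l * (w * (k - l) * w') - ν * l * (k - l)) := by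
    noncomm_ring
  rw [theta, theta, h1, map_add, map_add, map_sub, trace_conj_anticomm hν hl hd hw hw1,
    trace_mul_mul_eq_zero hν hk hd (anticomm_conj hk hw hw1 hw2)]
  simp

theorem theta_mul [FiniteDimensional F V] (hν : ν * ν = 0) (hk : ν * k + k * ν = 1)
    {w w' x x' : Module.End F V}
    (hw : w * w' = 1) (hw1 : ν * w = w * ν) (hx : x * x' = 1) (hx1 : ν * x = x * ν) :
    theta ν k (w * x) (x' * w') = theta ν k w w' + theta ν k x x' := by
  have h1 : ν * k * (w * x * k * (x' * w') - k) =
      ν * k * (w * (x * k * x' - k) * w') + ν * k * (w * k * w' - k) := by noncomm_ring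
  rw [theta, h1, map_add, trace_conj_anticomm hν hk
    (anticomm_conj hk hx hx1 (commute_inv hx hx1)) hw hw1]
  simp [theta, add_comm]

theorem theta_one_add (hk : ν * k + k * ν = 1) {z w' : Module.End F V}
    (hz : ν * z = 0) (hz' : z * ν = 0) (hw' : (1 + z) * w' = 1) :
    theta ν k (1 + z) w' = LinearMap.trace F V (z * k) := by
  have hzk : z = z * k * ν := by
    calc z = z * (ν * k + k * ν) := by rw [hk, mul_one]
      _ = (z * ν) * k + z * k * ν := by noncomm_ring
      _ = _ := by rw [hz']; simp
  have hzk' : ν * k * z = z := by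
    calc ν * k * z = (ν * k + k * ν) * z - k * (ν * z) := by noncomm_ring
      _ = z := by rw [hk, hz]; simp
  have hzz : z * z = 0 := by
    nth_rw 1 [hzk]
    rw [mul_assoc, hz, mul_zero]
  have hwz : w' = 1 - z := by
    have h1 : (1 - z) * ((1 + z) * w') = w' - z * z * w' := by noncomm_ring
    rw [hw', hzz] at h1
    simpa using h1.symm
  have h2 : ν * k * ((1 + z) * k * w' - k) =
      ν * k * z * k - ν * k * (k * z) - (ν * k * z) * k * z := by rw [hwz]; noncomm_ring
  rw [theta, h2, hzk', map_sub, map_sub, LinearMap.trace_mul_comm F (ν * k) (k * z),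
    LinearMap.trace_mul_comm F (z * k) z, show k * z * (ν * k) = k * (z * ν) * k by noncomm_ring,
    hz', ← mul_assoc z, hzz]
  simp

theorem trace_eq_add_of_exact [FiniteDimensional F V] {A C : Type} [AddCommGroup A] [Module F A]
    [AddCommGroup C]
    [Module F C] [FiniteDimensional F A] [FiniteDimensional F C] {i : A →ₗ[F] V} {p : V →ₗ[F] C}
    (hi : Function.Injective i) (hp : Function.Surjective p)
    (h : ∀ v, p v = 0 ↔ v ∈ LinearMap.range i) {f : Module.End F V} {a : Module.End F A}
    {c : Module.End F C} (ha : ∀ x, f (i x) = i (a x)) (hc : ∀ v, p (f v) = c (p v)) :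
    LinearMap.trace F V f = LinearMap.trace F A a + LinearMap.trace F C c := by
  obtain ⟨l, hl⟩ := i.exists_leftInverse_of_injective (LinearMap.ker_eq_bot.2 hi)
  obtain ⟨j, hj⟩ := p.exists_rightInverse_of_surjective (LinearMap.range_eq_top.2 hp)
  replace hl : ∀ x, l (i x) = x := LinearMap.congr_fun hl
  replace hj : ∀ x, p (j x) = x := LinearMap.congr_fun hj
  let r : V →ₗ[F] A := l ∘ₗ (LinearMap.id - j ∘ₗ p)
  have hpi : ∀ x, p (i x) = 0 := fun x => (h _).2 ⟨x, rfl⟩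
  have hr : ∀ v, i (r v) = v - j (p v) := by
    intro v
    obtain ⟨x, hx⟩ := (h (v - j (p v))).1 (by simp [hj])
    simp [r, ← hx, hl]
  have hri : ∀ x, r (i x) = x := fun x => hi (by simp [hr, hpi])
  have hf : f = (f ∘ₗ i) ∘ₗ r + (f ∘ₗ j) ∘ₗ p := by
    ext v
    simp [hr]
  have h1 : r ∘ₗ f ∘ₗ i = a := by
    ext x
    simp [ha, hri]
  have h2 : p ∘ₗ f ∘ₗ j = c := by
    ext x
    simp [hc, hj]
  rw [hf, map_add, LinearMap.trace_comp_comm' r, LinearMap.trace_comp_comm' p,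
    h1, h2]

end Theta

section Lift

variable {F V : Type} [Field F] [AddCommGroup V] [Module F V]

theorem exists_homotopy {ν : Module.End F V} (hν : ∀ v, ν (ν v) = 0)
    (hex : ∀ v, ν v = 0 → ∃ x, ν x = v) {V' E : Submodule F V}
    (hP : ∀ v ∈ V', ν v = 0 → ∃ x ∈ V', ν x = v)
    (hE : Disjoint E (V' ⊔ LinearMap.ker ν)) :
    ∃ k : Module.End F V, (∀ v, ν (k v) + k (ν v) = v) ∧ (∀ v ∈ V', k v ∈ V') ∧
      ∀ v ∈ E, k v = 0 := by
  obtain ⟨E'', hd'', hs''⟩ := IsModularLattice.exists_disjoint_and_sup_eq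
    (inf_le_left : V' ⊓ LinearMap.ker ν ≤ V')
  have hE'' : E'' ≤ V' := hs'' ▸ le_sup_right
  have hdis : Disjoint (E'' ⊔ E) (LinearMap.ker ν) := by
    rw [Submodule.disjoint_def]
    intro x hx hxν
    obtain ⟨y, hy, e, he, rfl⟩ := Submodule.mem_sup.1 hx
    have he0 : e = 0 := by
      refine (Submodule.disjoint_def.1 hE) e he ?_
      rw [show e = -y + (y + e) by abel]
      exact Submodule.add_mem_sup (V'.neg_mem (hE'' hy)) hxν
    rw [he0, add_zero] at hxν ⊢
    exact (Submodule.disjoint_def.1 hd'') y ⟨hE'' hy, hxν⟩ hy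
  obtain ⟨E', hle, hc⟩ := hdis.exists_isCompl
  have hinj : LinearMap.ker (ν ∘ₗ E'.subtype) = ⊥ := by
    rw [LinearMap.ker_eq_bot']
    exact fun e he => Subtype.ext ((Submodule.disjoint_def.1 hc.disjoint) e e.2 he)
  obtain ⟨l, hl⟩ := (ν ∘ₗ E'.subtype).exists_leftInverse_of_injective hinj
  let k : Module.End F V := E'.subtype ∘ₗ l ∘ₗ (LinearMap.ker ν).projection E' hc.symm
  have hk1 : ∀ e ∈ E', k (ν e) = e := by
    intro e he
    have h1 : (LinearMap.ker ν).projection E' hc.symm (ν e) = ν e :=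
      Submodule.projection_apply_of_mem_left _ (hν e)
    have h2 := LinearMap.congr_fun hl ⟨e, he⟩
    simp only [LinearMap.comp_apply, Submodule.subtype_apply, LinearMap.id_apply] at h2
    simp [k, h1, h2]
  have hk0 : ∀ e ∈ E', k e = 0 := by
    intro e he
    have h1 : (LinearMap.ker ν).projection E' hc.symm e = 0 :=
      (Submodule.projection_apply_eq_zero_iff _).2 he
    simp [k, h1]
  have hdec : ∀ v, ∃ p e, e ∈ E' ∧ ν p = 0 ∧ v = p + e := fun v =>
    ⟨_, _, Submodule.sub_projection_mem hc.symm v, Submodule.projection_apply_mem hc.symm v,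
      by abel⟩
  refine ⟨k, fun v => ?_, fun v hv => ?_, fun e he => hk0 e (hle (le_sup_right (a := E'') he))⟩
  · obtain ⟨p, e, he, hp, rfl⟩ := hdec v
    obtain ⟨x, rfl⟩ := hex p hp
    obtain ⟨p', e', he', hp', rfl⟩ := hdec x
    simp [hν, hp', hk1 e he, hk1 e' he', hk0 e he]
  · have hdec' : ∀ v ∈ V', ∃ p e, e ∈ E'' ∧ p ∈ V' ∧ ν p = 0 ∧ v = p + e := by
      intro v hv
      rw [← hs''] at hv
      obtain ⟨p, hp, e, he, rfl⟩ := Submodule.mem_sup.1 hv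
      exact ⟨p, e, he, hp.1, hp.2, rfl⟩
    obtain ⟨p, e, he, hpV, hp, rfl⟩ := hdec' v hv
    obtain ⟨x, hx, rfl⟩ := hP p hpV hp
    obtain ⟨p', e', he', hpV', hp', rfl⟩ := hdec' x hx
    rw [map_add, map_add, map_add, hp', map_zero, zero_add, hk0 e (hle (le_sup_left (b := E) he)),
      hk1 e' (hle (le_sup_left (b := E) he')), add_zero]
    exact hE'' he'

theorem exists_section_extension {D : Module.End F V} {E : Submodule F V} (hE : ∀ e ∈ E, D e = 0)
    (hdis : Disjoint (LinearMap.range D) E) {T : LinearMap.range D →ₗ[F] LinearMap.range D}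
    (hT : ∀ x y : LinearMap.range D, D x = y → D (T x) = T y) :
    ∃ τ : Module.End F V, (∀ x : LinearMap.range D, τ x = T x) ∧ (∀ e ∈ E, τ e = e) ∧
      ∀ v (y : LinearMap.range D), D v = y → D (τ v) = T y := by
  obtain ⟨j, hj⟩ := D.rangeRestrict.exists_rightInverse_of_surjective D.range_rangeRestrict
  have hj' : ∀ y : LinearMap.range D, D (j y) = y := fun y =>
    congrArg Subtype.val (LinearMap.congr_fun hj y)
  let τ₀ : Module.End F V := j ∘ₗ T ∘ₗ D.rangeRestrict
  have hτ₀ : ∀ v (y : LinearMap.range D), D v = y → D (τ₀ v) = T y := by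
    intro v y h
    rw [show τ₀ v = j (T (D.rangeRestrict v)) from rfl, hj',
      show D.rangeRestrict v = y from Subtype.ext h]
  obtain ⟨C, hEC, hC⟩ := hdis.symm.exists_isCompl
  let p := (LinearMap.range D).projectionOnto C hC.symm
  let f₁ : V →ₗ[F] V :=
    (((LinearMap.range D).subtype ∘ₗ T) - τ₀ ∘ₗ (LinearMap.range D).subtype) ∘ₗ p
  obtain ⟨B, hB⟩ := E.exists_isCompl
  let q := E.projection B hB
  let f₂ : V →ₗ[F] V := (q - τ₀ ∘ₗ q) ∘ₗ (LinearMap.id - (LinearMap.range D).projection C hC.symm)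
  have hDf₁ : ∀ v, D (f₁ v) = 0 := by
    intro v
    have := hT (p v) ⟨D (p v), ⟨_, rfl⟩⟩ rfl
    simp [f₁, hτ₀ (p v) ⟨D (p v), ⟨_, rfl⟩⟩ rfl, this]
  have hDq : ∀ v, D (q v) = 0 := fun v => hE _ (Submodule.projection_apply_mem hB v)
  have hDf₂ : ∀ v, D (f₂ v) = 0 := by
    intro v
    have h := fun w => hτ₀ (q w) 0 (hDq w)
    simp only [f₂, LinearMap.comp_apply, LinearMap.sub_apply, map_sub, hDq, h]
    simp
  refine ⟨τ₀ + f₁ + f₂, fun x => ?_, fun e he => ?_, fun v y h => ?_⟩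
  · simp [f₁, f₂, p]
  · have h1 : p e = 0 := (Submodule.projectionOnto_apply_eq_zero_iff _).2 (hEC he)
    have h2 : (LinearMap.range D).projection C hC.symm e = 0 :=
      (Submodule.projection_apply_eq_zero_iff _).2 (hEC he)
    have h3 : q e = e := Submodule.projection_apply_of_mem_left _ he
    simp [f₁, f₂, h1, h2, h3]
  · simp [hDf₁, hDf₂, hτ₀ v y h]

theorem exists_lift [FiniteDimensional F V] {ν ν' σ σ' D : Module.End F V}
    (hν : ∀ v, ν (ν v) = 0) (hν' : ∀ v, ν' (ν' v) = 0) (hσ : ∀ v, σ (σ v) = 0)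
    (hσ' : ∀ v, σ' (σ' v) = 0) (hD : ∀ v, D v = ν v - ν' v) (hDσ : ∀ v, D v = σ v - σ' v)
    (hex : ∀ v, ν v = 0 → ∃ x, ν x = v) (hP : ∀ v, ν (D v) = 0 → ∃ x, ν (D x) = D v)
    {c : F} (hc : c ≠ 0) (hσν : ∀ v, ∃ x, σ v = c • ν v + D x)
    (T' : LinearMap.range D ≃ₗ[F] LinearMap.range D)
    (hT : ∀ x y : LinearMap.range D, ν x = y → (T' y : V) = σ (T' x))
    (hT' : ∀ x y : LinearMap.range D, ν' x = y → (T' y : V) = σ' (T' x)) :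
    ∃ T : V ≃ₗ[F] V, (∀ x : LinearMap.range D, T x = T' x) ∧ (∀ v, T (ν v) = σ (T v)) ∧
      ∀ v, T (ν' v) = σ' (T v) := by
  have hνD : ∀ v, ν (D v) = -D (ν' v) := fun v => by simp [hD, hν, hν']
  have hDν : ∀ v, D (ν v) = -ν' (D v) := fun v => by simp [hD, hν, hν']
  have hDσ' : ∀ v, D (σ v) = -σ' (D v) := fun v => by simp [hDσ, hσ, hσ']
  have hDT : ∀ x y : LinearMap.range D, D x = y → D (T' x) = T' y := by
    intro x y h
    have hνx : ν x ∈ LinearMap.range D := by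
      obtain ⟨z, hz⟩ := x.2
      exact ⟨-ν' z, by rw [← hz, hνD, map_neg]⟩
    have h1 := hT x ⟨_, hνx⟩ rfl
    have hx' : ν' x = (⟨_, hνx⟩ - y : LinearMap.range D) := by simp [← h, hD]
    have h2 := hT' x _ hx'
    rw [hDσ, ← h1, ← h2, map_sub]
    simp
  set P := LinearMap.ker ν with hPdef
  set M := LinearMap.range D ⊔ P with hM
  obtain ⟨E, hdE, hsE⟩ := IsModularLattice.exists_disjoint_and_sup_eq
    (inf_le_left : LinearMap.ker D ⊓ M ≤ LinearMap.ker D)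
  have hED : ∀ e ∈ E, D e = 0 := fun e he => (hsE ▸ le_sup_right : E ≤ LinearMap.ker D) he
  have hEM : Disjoint E M := by
    rw [Submodule.disjoint_def]
    exact fun e he heM => (Submodule.disjoint_def.1 hdE) e ⟨hED e he, heM⟩ he
  obtain ⟨τ, hτ1, hτ2, hτ3⟩ := exists_section_extension hED
    (hEM.mono_right le_sup_left).symm (T := T'.toLinearMap) hDT
  obtain ⟨k, hk, hkV, hkE⟩ := exists_homotopy hν hex (V' := LinearMap.range D)
    (by
      rintro _ ⟨v, rfl⟩ h
      obtain ⟨x, hx⟩ := hP v h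
      exact ⟨_, ⟨x, rfl⟩, hx⟩) hEM
  let T : Module.End F V := τ ∘ₗ k ∘ₗ ν + σ ∘ₗ τ ∘ₗ k
  have hTdef : ∀ v, T v = τ (k (ν v)) + σ (τ (k v)) := fun v => rfl
  have hTν : ∀ v, T (ν v) = σ (T v) := fun v => by simp [hTdef, hν, hσ]
  have hTV : ∀ x : LinearMap.range D, T x = T' x := by
    intro x
    have hνx : ν x ∈ LinearMap.range D := by
      obtain ⟨z, hz⟩ := x.2
      exact ⟨-ν' z, by rw [← hz, hνD, map_neg]⟩
    let y : LinearMap.range D := ⟨_, hkV _ hνx⟩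
    let z : LinearMap.range D := ⟨_, hkV _ x.2⟩
    have h1 : T x = τ y + σ (τ z) := rfl
    have hνz : ν z = (x - y : LinearMap.range D) := by
      simp only [Submodule.coe_sub, y, z]
      rw [eq_sub_iff_add_eq, hk]
    have h2 := hT z _ hνz
    rw [h1, hτ1, hτ1]
    simp only [LinearEquiv.coe_coe]
    rw [← h2, map_sub]
    simp
  have hDT2 : ∀ v (y : LinearMap.range D), D v = y → D (T v) = T' y := by
    intro v y h
    rw [hTdef, map_add, hDσ']
    have h1 := hτ3 (k (ν v)) ⟨_, ⟨_, rfl⟩⟩ rfl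
    have h2 := hτ3 (k v) ⟨_, ⟨_, rfl⟩⟩ rfl
    simp only [LinearEquiv.coe_coe] at h1 h2
    have h3 : ν' (D (k v)) = ((⟨D (k (ν v)), ⟨_, rfl⟩⟩ - y : LinearMap.range D) : V) := by
      have h4 : D v = -ν' (D (k v)) + D (k (ν v)) := by
        conv_lhs => rw [← hk v]
        rw [map_add, hDν]
      rw [Submodule.coe_sub, ← h, h4]
      abel
    have h4 := hT' ⟨D (k v), ⟨_, rfl⟩⟩ _ h3
    rw [h1, h2, ← h4, map_sub]
    simp
  have hTν' : ∀ v, T (ν' v) = σ' (T v) := by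
    intro v
    have h1 : ν' v = ν v - D v := by simp [hD]
    have h2 : σ' (T v) = σ (T v) - D (T v) := by simp [hDσ]
    rw [h1, h2, map_sub, hTν, hDT2 v ⟨D v, ⟨_, rfl⟩⟩ rfl, ← hTV]
  have hTE : ∀ e ∈ E, T e = e := by
    intro e he
    have h1 := hk e
    rw [hkE e he, map_zero, zero_add] at h1
    rw [hTdef, h1, hkE e he, hτ2 e he]
    simp
  have hσM : ∀ v, σ v ∈ M := by
    intro v
    obtain ⟨x, hx⟩ := hσν v
    rw [hx, add_comm]
    exact Submodule.add_mem_sup ⟨x, rfl⟩ (P.smul_mem c (hν v))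
  have hTM : ∀ v ∈ M, T v ∈ M := by
    intro v hv
    obtain ⟨x, hx, p, hp, rfl⟩ := Submodule.mem_sup.1 hv
    obtain ⟨y, rfl⟩ := hex p hp
    rw [map_add, hTν]
    refine M.add_mem (Submodule.mem_sup_left ?_) (hσM _)
    rw [hTV ⟨x, hx⟩]
    exact (T' ⟨x, hx⟩).2
  have hEM' : ∀ e ∈ E, e ∈ M → e = 0 := Submodule.disjoint_def.1 hEM
  have hker : ∀ v, D v = 0 → ∃ y ∈ M, D y = 0 ∧ ∃ e ∈ E, v = y + e := by
    intro v hv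
    have : v ∈ LinearMap.ker D := hv
    rw [← hsE] at this
    obtain ⟨y, hy, e, he, rfl⟩ := Submodule.mem_sup.1 this
    exact ⟨y, hy.2, hy.1, e, he, rfl⟩
  have hinj : ∀ v, T v = 0 → v = 0 := by
    intro v hv
    have hDv : D v = 0 := by
      have := hDT2 v ⟨D v, ⟨_, rfl⟩⟩ rfl
      rw [hv, map_zero, eq_comm, ZeroMemClass.coe_eq_zero, LinearEquiv.map_eq_zero_iff] at this
      exact congrArg Subtype.val this
    obtain ⟨y, hy, -, e, he, rfl⟩ := hker v hDv
    have he0 : e = 0 := by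
      refine hEM' e he ?_
      rw [map_add, hTE e he] at hv
      rw [eq_neg_of_add_eq_zero_right hv]
      exact M.neg_mem (hTM y hy)
    rw [he0, add_zero] at hv ⊢
    obtain ⟨x, hx, p, hp, rfl⟩ := Submodule.mem_sup.1 hy
    obtain ⟨f, rfl⟩ := hex p hp
    have hσT : σ (T f) ∈ LinearMap.range D := by
      rw [map_add, hTν, hTV ⟨x, hx⟩] at hv
      rw [eq_neg_of_add_eq_zero_right hv]
      exact Submodule.neg_mem _ (T' ⟨x, hx⟩).2
    have hTf : T f ∈ M := by
      obtain ⟨a, ha⟩ := hσν (T f)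
      obtain ⟨b, hb⟩ := hσT
      have h1 : ν (T f) = D (c⁻¹ • (b - a)) := by
        rw [map_smul, map_sub, hb, ha, add_sub_cancel_right, inv_smul_smul₀ hc]
      obtain ⟨d, hd⟩ := hP (c⁻¹ • (b - a)) (by rw [← h1, hν])
      rw [show T f = D d + (T f - D d) by abel]
      exact Submodule.add_mem_sup ⟨d, rfl⟩ (by
        rw [hPdef, LinearMap.mem_ker, map_sub, hd, h1, sub_self])
    let L := (M.map D).comap (LinearMap.range D).subtype
    have hL : L.map T'.toLinearMap = L := by
      refine Submodule.eq_of_le_of_finrank_eq ?_ (LinearEquiv.finrank_map_eq T' L)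
      rintro _ ⟨y, ⟨m, hm, hmy⟩, rfl⟩
      exact ⟨T m, hTM m hm, hDT2 m y hmy⟩
    have hDf : D f ∈ M.map D := by
      have h1 : T' ⟨D f, ⟨f, rfl⟩⟩ ∈ L.map T'.toLinearMap := by
        rw [hL]
        exact ⟨T f, hTf, hDT2 f _ rfl⟩
      obtain ⟨y, hy, hy'⟩ := h1
      have h2 : y = ⟨D f, ⟨f, rfl⟩⟩ := T'.injective hy'
      rw [h2] at hy
      exact hy
    obtain ⟨m, hm, hmf⟩ := hDf
    obtain ⟨y, hy, -, e, he, hye⟩ := hker (f - m) (by rw [map_sub, hmf, sub_self])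
    have hf : f = m + y + e := by rw [add_assoc, ← hye]; abel
    have he0' : e = 0 := by
      refine hEM' e he ?_
      rw [hf, map_add, hTE e he] at hTf
      exact (M.add_mem_iff_right (hTM _ (M.add_mem hm hy))).1 hTf
    have hfM : f ∈ M := by
      rw [hf, he0', add_zero]
      exact M.add_mem hm hy
    obtain ⟨_, ⟨b, rfl⟩, p', hp', rfl⟩ := Submodule.mem_sup.1 hfM
    have hνf : ν (D b + p') ∈ LinearMap.range D := by
      rw [map_add, show ν p' = 0 from hp', add_zero, hνD]
      exact Submodule.neg_mem _ ⟨_, rfl⟩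
    let z : LinearMap.range D := ⟨_, Submodule.add_mem _ hx hνf⟩
    have h1 : (T' z : V) = 0 := by rw [← hTV z]; exact hv
    rw [ZeroMemClass.coe_eq_zero, LinearEquiv.map_eq_zero_iff] at h1
    exact congrArg Subtype.val h1
  refine ⟨LinearEquiv.ofInjectiveEndo T (LinearMap.ker_eq_bot.1 (LinearMap.ker_eq_bot'.2 hinj)),
    hTV, hTν, hTν'⟩

end Lift

section Swap

variable {F : Type} [Field F] {ψ : AddChar F ℂ}

theorem exists_preimage_range {V : Type} [AddCommGroup V] [Module F V] [FiniteDimensional F V]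
    (hψ : ∃ a, ψ a ≠ 1) {ν ν' k k' : Module.End F V} (hν : ν * ν = 0)
    (hν' : ν' * ν' = 0) (hk : ν * k + k * ν = 1) (hk' : ν' * k' + k' * ν' = 1)
    (H : ∀ w w' : Module.End F V, w * w' = 1 → ν * w = w * ν → ν' * w = w * ν' →
      ψ (theta ν k w w' - theta ν' k' w w') = 1)
    {v : V} (hv : ν (ν v - ν' v) = 0) : ∃ x, ν (ν x - ν' x) = ν v - ν' v := by
  have eν : ∀ v, ν (ν v) = 0 := LinearMap.congr_fun hν
  have eν' : ∀ v, ν' (ν' v) = 0 := LinearMap.congr_fun hν'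
  have ek : ∀ v, ν (k v) + k (ν v) = v := LinearMap.congr_fun hk
  have ek' : ∀ v, ν' (k' v) + k' (ν' v) = v := LinearMap.congr_fun hk'
  have key : ∀ r, ν r = 0 → ν' r = 0 → k r - k' r ∈ LinearMap.range ν ⊔ LinearMap.range ν' := by
    intro r hr hr'
    by_contra hnot
    obtain ⟨f, hf, hle⟩ := Submodule.exists_le_ker_of_notMem hnot
    have hfν : ∀ v, f (ν v) = 0 := fun v => hle (Submodule.mem_sup_left ⟨v, rfl⟩)
    have hfν' : ∀ v, f (ν' v) = 0 := fun v => hle (Submodule.mem_sup_right ⟨v, rfl⟩)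
    obtain ⟨a, ha⟩ := hψ
    let c := a / f (k r - k' r)
    let X : Module.End F V := (c • f).smulRight r
    have hX : ∀ v, X v = (c * f v) • r := fun v => rfl
    have hνX : ν * X = 0 := by ext v; simp [hX, hr]
    have hνX' : ν' * X = 0 := by ext v; simp [hX, hr']
    have hXν : X * ν = 0 := by ext v; simp [hX, hfν]
    have hXν' : X * ν' = 0 := by ext v; simp [hX, hfν']
    have hfr : f r = 0 := by
      have := ek r
      rw [hr, map_zero, add_zero] at this
      rw [← this, hfν]
    have hXX : X * X = 0 := by ext v; simp [hX, hfr]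
    have hinv : (1 + X) * (1 - X) = 1 := by
      rw [show (1 + X) * (1 - X) = 1 - X * X by noncomm_ring, hXX, sub_zero]
    have htr : ∀ l : Module.End F V, LinearMap.trace F V (X * l) = c * f (l r) := by
      intro l
      have : X * l = ((c • f) ∘ₗ l).smulRight r := rfl
      rw [this, LinearMap.trace_smulRight]
      simp
    have h1 := H (1 + X) (1 - X) hinv (by rw [mul_add, add_mul, hνX, hXν]; simp)
      (by rw [mul_add, add_mul, hνX', hXν']; simp)
    rw [theta_one_add hk hνX hXν hinv, theta_one_add hk' hνX' hXν' hinv, htr, htr, ← mul_sub,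
      ← map_sub, div_mul_cancel₀ _ hf] at h1
    exact ha h1
  have hr : ν (ν' v) = 0 := by
    rw [map_sub, eν, zero_sub, neg_eq_zero] at hv
    exact hv
  obtain ⟨p, ⟨p, rfl⟩, q, ⟨q, rfl⟩, hpq⟩ := Submodule.mem_sup.1 (key (ν' v) hr (eν' v))
  have h1 : ν' v = ν (k (ν' v)) := by
    have := ek (ν' v)
    rw [hr, map_zero, add_zero] at this
    exact this.symm
  have h2 : v = ν' (k' v) + k' (ν' v) := (ek' v).symm
  have h3 : k (ν' v) = k' (ν' v) + (ν p + ν' q) := by rw [hpq]; abel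
  refine ⟨q - k' v, ?_⟩
  have h4 : ν v - ν' v = ν (ν' (k' v)) - ν (ν' q) := by
    have h5 : ν v = ν (ν' (k' v)) + ν (k' (ν' v)) := by rw [← map_add, ← h2]
    rw [h3, map_add, map_add, eν, zero_add] at h1
    rw [h5, eq_sub_of_add_eq h1.symm]
    abel
  rw [h4]
  simp [eν]

theorem theta_eq_add_of_exact {A V C : Type} [AddCommGroup A] [Module F A] [AddCommGroup V]
    [Module F V] [AddCommGroup C] [Module F C] [FiniteDimensional F A] [FiniteDimensional F V]
    [FiniteDimensional F C] {i : A →ₗ[F] V} {p : V →ₗ[F] C}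
    (hi : Function.Injective i) (hp : Function.Surjective p)
    (h : ∀ v, p v = 0 ↔ v ∈ LinearMap.range i) {ν k w w' : Module.End F V}
    {ν₁ k₁ w₁ w₁' : Module.End F A} {ν₂ k₂ w₂ w₂' : Module.End F C}
    (h1 : ∀ x, ν (i x) = i (ν₁ x)) (h2 : ∀ x, k (i x) = i (k₁ x)) (h3 : ∀ x, w (i x) = i (w₁ x))
    (h4 : ∀ x, w' (i x) = i (w₁' x)) (h1' : ∀ v, p (ν v) = ν₂ (p v))
    (h2' : ∀ v, p (k v) = k₂ (p v)) (h3' : ∀ v, p (w v) = w₂ (p v))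
    (h4' : ∀ v, p (w' v) = w₂' (p v)) :
    theta ν k w w' = theta ν₁ k₁ w₁ w₁' + theta ν₂ k₂ w₂ w₂' :=
  trace_eq_add_of_exact hi hp h (by simp [h1, h2, h3, h4]) (by simp [h1', h2', h3', h4'])

theorem exists_swap (hψ : ∃ a, ψ a ≠ 1) (N : ℕ) : ∀ {V : Type} [AddCommGroup V] [Module F V]
    [FiniteDimensional F V], Module.finrank F V ≤ N → ∀ {ν ν' k k' : Module.End F V},
    ν * ν = 0 → ν' * ν' = 0 → ν * k + k * ν = 1 → ν' * k' + k' * ν' = 1 →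
    (∀ w w' : Module.End F V, w * w' = 1 → ν * w = w * ν → ν' * w = w * ν' →
      ψ (theta ν k w w' - theta ν' k' w w') = 1) →
    ∃ T : V ≃ₗ[F] V, (∀ v, T (ν v) = -ν' (T v)) ∧ ∀ v, T (ν' v) = -ν (T v) := by
  induction N using Nat.strong_induction_on with
  | _ N ih =>
  intro V _ _ _ hN ν ν' k k' hν hν' hk hk' H
  have eν : ∀ v, ν (ν v) = 0 := LinearMap.congr_fun hν
  have eν' : ∀ v, ν' (ν' v) = 0 := LinearMap.congr_fun hν'
  have ek : ∀ v, ν (k v) + k (ν v) = v := LinearMap.congr_fun hk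
  have ek' : ∀ v, ν' (k' v) + k' (ν' v) = v := LinearMap.congr_fun hk'
  obtain ⟨D, hD⟩ : ∃ D : Module.End F V, ∀ v, D v = ν v - ν' v := ⟨ν - ν', fun v => rfl⟩
  by_cases hinj : Function.Injective D
  · exact ⟨LinearEquiv.ofInjectiveEndo D hinj, by simp [hD, eν, eν'], by simp [hD, eν, eν']⟩
  have hlt : Module.finrank F (LinearMap.range D) < Module.finrank F V := by
    refine Submodule.finrank_lt fun htop => hinj ?_
    exact LinearMap.injective_iff_surjective.2 (LinearMap.range_eq_top.1 htop)
  have hex : ∀ v, ν v = 0 → ∃ x, ν x = v := fun v hv => ⟨k v, by simpa [hv] using ek v⟩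
  have hex' : ∀ v, ν' v = 0 → ∃ x, ν' x = v := fun v hv => ⟨k' v, by simpa [hv] using ek' v⟩
  have hP : ∀ v, ν (D v) = 0 → ∃ x, ν (D x) = D v := by
    intro v hv
    simp only [hD] at hv ⊢
    exact exists_preimage_range hψ hν hν' hk hk' H hv
  have hP' : ∀ v, ν' (D v) = 0 → ∃ x, ν' (D x) = D v := by
    intro v hv
    obtain ⟨x, hx⟩ := exists_preimage_range hψ hν' hν hk' hk (v := -v) (fun w w' h h1 h2 => by
      rw [← neg_sub, AddChar.map_neg_eq_inv, H w w' h h2 h1, inv_one]) (by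
        rw [hD, map_sub] at hv
        rw [map_sub, map_neg, map_neg, map_neg, map_neg, ← neg_sub', neg_sub]
        exact hv)
    exact ⟨-x, by rw [hD, hD]; simpa [neg_add_eq_sub] using hx⟩
  have hVν : ∀ x ∈ LinearMap.range D, ν x ∈ LinearMap.range D := by
    rintro _ ⟨x, rfl⟩
    exact ⟨-ν' x, by simp [hD, eν, eν']⟩
  have hVν' : ∀ x ∈ LinearMap.range D, ν' x ∈ LinearMap.range D := by
    rintro _ ⟨x, rfl⟩
    exact ⟨-ν x, by simp [hD, eν, eν']⟩
  obtain ⟨l, hl, hlV, -⟩ := exists_homotopy (E := ⊥) eν hex (V' := LinearMap.range D)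
    (by
      rintro _ ⟨v, rfl⟩ h
      obtain ⟨x, hx⟩ := hP v h
      exact ⟨_, ⟨x, rfl⟩, hx⟩) disjoint_bot_left
  obtain ⟨l', hl', hlV', -⟩ := exists_homotopy (E := ⊥) eν' hex' (V' := LinearMap.range D)
    (by
      rintro _ ⟨v, rfl⟩ h
      obtain ⟨x, hx⟩ := hP' v h
      exact ⟨_, ⟨x, rfl⟩, hx⟩) disjoint_bot_left
  have hl1 : ν * l + l * ν = 1 := LinearMap.ext hl
  have hl1' : ν' * l' + l' * ν' = 1 := LinearMap.ext hl'
  obtain ⟨T', hT1, hT2⟩ := ih _ (hlt.trans_le hN) (V := LinearMap.range D) le_rfl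
    (ν := ν.restrict hVν) (ν' := ν'.restrict hVν') (k := l.restrict hlV) (k' := l'.restrict hlV')
    (LinearMap.ext fun x => Subtype.ext (eν x)) (LinearMap.ext fun x => Subtype.ext (eν' x))
    (LinearMap.ext fun x => Subtype.ext (hl x)) (LinearMap.ext fun x => Subtype.ext (hl' x)) (by
      intro w w' hw hwν hwν'
      let T' : LinearMap.range D ≃ₗ[F] LinearMap.range D :=
        LinearEquiv.ofLinearMap w w' hw (mul_eq_one_comm.1 hw)
      obtain ⟨T, hT, hTν, hTν'⟩ := exists_lift eν eν' eν eν' hD hD hex hP one_ne_zero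
        (fun v => ⟨0, by simp⟩) T'
        (fun x y h => by
          have h1 : y = ν.restrict hVν x := Subtype.ext h.symm
          rw [h1]
          exact congrArg Subtype.val (LinearMap.congr_fun hwν x).symm)
        (fun x y h => by
          have h1 : y = ν'.restrict hVν' x := Subtype.ext h.symm
          rw [h1]
          exact congrArg Subtype.val (LinearMap.congr_fun hwν' x).symm)
      have hTs : ∀ x : LinearMap.range D, T.symm x = T'.symm x := fun x => by
        rw [LinearEquiv.symm_apply_eq, hT, LinearEquiv.apply_symm_apply]
      have hTT : T.toLinearMap * T.symm.toLinearMap = 1 := LinearMap.ext T.apply_symm_apply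
      have hcν : ν * T.toLinearMap = T.toLinearMap * ν := LinearMap.ext fun v => (hTν v).symm
      have hcν' : ν' * T.toLinearMap = T.toLinearMap * ν' := LinearMap.ext fun v => (hTν' v).symm
      have h1 := H T.toLinearMap T.symm.toLinearMap hTT hcν hcν'
      have hTle : LinearMap.range D ≤ (LinearMap.range D).comap T.toLinearMap := fun x hx => by
        rw [Submodule.mem_comap, show T.toLinearMap x = _ from hT ⟨x, hx⟩]
        exact (T' ⟨x, hx⟩).2
      have hTle' : LinearMap.range D ≤ (LinearMap.range D).comap T.symm.toLinearMap :=
          fun x hx => by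
        rw [Submodule.mem_comap, show T.symm.toLinearMap x = _ from hTs ⟨x, hx⟩]
        exact (T'.symm ⟨x, hx⟩).2
      have hquot : (LinearMap.range D).mapQ (LinearMap.range D) ν' hVν' =
          (LinearMap.range D).mapQ (LinearMap.range D) ν hVν := by
        refine Submodule.linearMap_qext _ (LinearMap.ext fun v => ?_)
        rw [LinearMap.comp_apply, LinearMap.comp_apply, Submodule.mkQ_apply, Submodule.mapQ_apply,
          Submodule.mapQ_apply, eq_comm, Submodule.Quotient.eq]
        exact ⟨v, hD v⟩
      have hexact : ∀ v, (LinearMap.range D).mkQ v = 0 ↔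
          v ∈ LinearMap.range (LinearMap.range D).subtype := fun v => by simp
      rw [theta_indep hν hk hl1 hTT hcν, theta_indep hν' hk' hl1' hTT hcν',
        theta_eq_add_of_exact (LinearMap.range D).subtype_injective
          (Submodule.mkQ_surjective _) hexact (ν₁ := ν.restrict hVν) (k₁ := l.restrict hlV)
          (w₁ := w) (w₁' := w') (ν₂ := Submodule.mapQ (LinearMap.range D) (LinearMap.range D) ν hVν)
              (k₂ := Submodule.mapQ (LinearMap.range D) (LinearMap.range D) l hlV)
          (w₂ := Submodule.mapQ (LinearMap.range D) (LinearMap.range D) T.toLinearMap hTle)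
          (w₂' := Submodule.mapQ (LinearMap.range D) (LinearMap.range D) T.symm.toLinearMap hTle')
          (fun _ => rfl) (fun _ => rfl) hT hTs (fun _ => rfl) (fun _ => rfl) (fun _ => rfl)
          (fun _ => rfl),
        theta_eq_add_of_exact (LinearMap.range D).subtype_injective
          (Submodule.mkQ_surjective _) hexact (ν₁ := ν'.restrict hVν') (k₁ := l'.restrict hlV')
          (w₁ := w) (w₁' := w') (ν₂ := Submodule.mapQ (LinearMap.range D) (LinearMap.range D) ν' hVν')
              (k₂ := Submodule.mapQ (LinearMap.range D) (LinearMap.range D) l' hlV')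
          (w₂ := Submodule.mapQ (LinearMap.range D) (LinearMap.range D) T.toLinearMap hTle)
          (w₂' := Submodule.mapQ (LinearMap.range D) (LinearMap.range D) T.symm.toLinearMap hTle')
          (fun _ => rfl) (fun _ => rfl) hT hTs (fun _ => rfl) (fun _ => rfl) (fun _ => rfl)
          (fun _ => rfl),
        hquot, theta_indep (k := Submodule.mapQ (LinearMap.range D) (LinearMap.range D) l hlV)
            (l := Submodule.mapQ (LinearMap.range D) (LinearMap.range D) l' hlV'),
        add_sub_add_right_eq_sub] at h1
      · exact h1
      · exact Submodule.linearMap_qext _ (LinearMap.ext fun v => congrArg (Submodule.mkQ _) (eν v))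
      · exact Submodule.linearMap_qext _ (LinearMap.ext fun v => congrArg (Submodule.mkQ _) (hl v))
      · rw [← hquot]
        exact Submodule.linearMap_qext _ (LinearMap.ext fun v => congrArg (Submodule.mkQ _) (hl' v))
      · exact Submodule.linearMap_qext _
          (LinearMap.ext fun v => congrArg (Submodule.mkQ _) (T.apply_symm_apply v))
      · exact Submodule.linearMap_qext _
          (LinearMap.ext fun v => congrArg (Submodule.mkQ _) (hTν v).symm))
  obtain ⟨T, -, hTν, hTν'⟩ := exists_lift (σ := -ν') (σ' := -ν) eν eν' (by simp [eν'])
    (by simp [eν]) hD (fun v => by simp [hD, neg_add_eq_sub]) hex hP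
    (neg_ne_zero.2 one_ne_zero : (-1 : F) ≠ 0)
    (fun v => ⟨v, by simp [hD, neg_add_eq_sub, sub_eq_add_neg]⟩) T'
    (fun x y h => by
      have h1 : y = ν.restrict hVν x := Subtype.ext h.symm
      rw [h1, hT1]
      rfl)
    (fun x y h => by
      have h1 : y = ν'.restrict hVν' x := Subtype.ext h.symm
      rw [h1, hT2]
      rfl)
  exact ⟨T, hTν, hTν'⟩

end Swap

section Averaging

variable {G : Type} [Group G]

theorem char_inv_mul {K : Subgroup G} {χ : K →* ℂ} (k : K) : χ k⁻¹ * χ k = 1 := by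
  rw [← map_mul, inv_mul_cancel, map_one]

variable [Finite G] {W : Type} [AddCommGroup W] [Module ℂ W]

instance fintypeSubgroup (K : Subgroup G) : Fintype K := Fintype.ofFinite K

/-- The projection onto the `χ`-eigenvectors of the subgroup `K`. -/
def eigenProj (ϖ : Representation ℂ G W) (K : Subgroup G) (χ : K →* ℂ) : Module.End ℂ W :=
  (Fintype.card K : ℂ)⁻¹ • ∑ k : K, χ k⁻¹ • ϖ k

variable {ϖ : Representation ℂ G W} {K : Subgroup G} {χ : K →* ℂ}

theorem apply_eigenProj_of_eigen {M : Type*} [AddCommGroup M] [Module ℂ M]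
    (T : Module.End ℂ W →ₗ[ℂ] M) (m : M) (h : ∀ k : K, T (ϖ k) = χ k • m) :
    T (eigenProj ϖ K χ) = m := by
  have hc : (Fintype.card K : ℂ) ≠ 0 := Nat.cast_ne_zero.2 Fintype.card_ne_zero
  simp only [eigenProj, map_smul, map_sum, h, smul_smul, char_inv_mul]
  rw [one_smul, Finset.sum_const, Finset.card_univ, ← Nat.cast_smul_eq_nsmul ℂ, smul_smul,
    inv_mul_cancel₀ hc, one_smul]

theorem mul_eigenProj_of_eigen {T : Module.End ℂ W} (h : ∀ k : K, T * ϖ k = χ k • T) :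
    T * eigenProj ϖ K χ = T :=
  apply_eigenProj_of_eigen (LinearMap.mulLeft ℂ T) T h

theorem eigenProj_mul_of_eigen {T : Module.End ℂ W} (h : ∀ k : K, ϖ k * T = χ k • T) :
    eigenProj ϖ K χ * T = T :=
  apply_eigenProj_of_eigen (LinearMap.mulRight ℂ T) T h

theorem eigenProj_apply_of_eigen {w : W} (h : ∀ k : K, ϖ k w = χ k • w) :
    eigenProj ϖ K χ w = w :=
  apply_eigenProj_of_eigen (LinearMap.applyₗ w) w h

theorem functional_eigenProj {ℓ : Module.Dual ℂ W} (h : ∀ (k : K) w, ℓ (ϖ k w) = χ k * ℓ w)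
    (w : W) : ℓ (eigenProj ϖ K χ w) = ℓ w :=
  apply_eigenProj_of_eigen (ℓ ∘ₗ LinearMap.applyₗ w) (ℓ w) fun k => h k w

theorem mul_eigenProj (k : K) : ϖ k * eigenProj ϖ K χ = χ k • eigenProj ϖ K χ := by
  rw [eigenProj, mul_smul_comm, smul_comm (χ k), Finset.mul_sum, Finset.smul_sum (r := χ k)]
  refine congrArg _ (Fintype.sum_equiv (Equiv.mulLeft k) _ _ fun x => ?_)
  rw [Equiv.coe_mulLeft, _root_.mul_inv_rev, map_mul χ, Subgroup.coe_mul, map_mul ϖ, smul_smul,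
    mul_smul_comm, mul_left_comm, mul_comm (χ k), char_inv_mul, mul_one]

theorem eigenProj_mul (k : K) : eigenProj ϖ K χ * ϖ k = χ k • eigenProj ϖ K χ := by
  rw [eigenProj, smul_mul_assoc, smul_comm (χ k), Finset.sum_mul, Finset.smul_sum (r := χ k)]
  refine congrArg _ (Fintype.sum_equiv (Equiv.mulRight k) _ _ fun x => ?_)
  rw [Equiv.coe_mulRight, _root_.mul_inv_rev, map_mul χ, Subgroup.coe_mul, map_mul ϖ, smul_smul,
    smul_mul_assoc, ← mul_assoc, mul_comm (χ k), char_inv_mul, one_mul]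

theorem eigenProj_mul_self : eigenProj ϖ K χ * eigenProj ϖ K χ = eigenProj ϖ K χ :=
  mul_eigenProj_of_eigen eigenProj_mul

theorem trace_eigenProj_ne_zero [FiniteDimensional ℂ W] (h : eigenProj ϖ K χ ≠ 0) :
    LinearMap.trace ℂ W (eigenProj ϖ K χ) ≠ 0 := fun h0 =>
  h ((LinearMap.IsIdempotentElem.trace_eq_zero_iff eigenProj_mul_self).1 h0)

end Averaging

section Subrep

variable {G : Type} [Group G] {W : Type} [AddCommGroup W] [Module ℂ W]

/-- The restriction of a representation to an invariant subspace. -/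
def subRep (ϖ : Representation ℂ G W) (K : Submodule ℂ W) (hK : ∀ g, ∀ w ∈ K, ϖ g w ∈ K) :
    Representation ℂ G K where
  toFun g := (ϖ g).restrict (hK g)
  map_one' := by ext w; simp
  map_mul' g h := by ext w; simp

/-- The class sums of each element and of its inverse act in the same way. -/
def ClassSym [Fintype G] (ϖ : Representation ℂ G W) : Prop :=
  ∀ s, ∑ g, ϖ (g * s * g⁻¹) = ∑ g, ϖ (g * s⁻¹ * g⁻¹)

theorem ClassSym.trace_eq [Fintype G] {ϖ : Representation ℂ G W} (h : ClassSym ϖ)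
    {η : Module.End ℂ W} (hη : ∀ g, ϖ g * η = η * ϖ g) (s : G) :
    LinearMap.trace ℂ W (ϖ s * η) = LinearMap.trace ℂ W (ϖ s⁻¹ * η) := by
  have key : ∀ s, LinearMap.trace ℂ W ((∑ g, ϖ (g * s * g⁻¹)) * η) =
      Fintype.card G * LinearMap.trace ℂ W (ϖ s * η) := by
    intro s
    have : ∀ g, LinearMap.trace ℂ W (ϖ (g * s * g⁻¹) * η) = LinearMap.trace ℂ W (ϖ s * η) := by
      intro g
      rw [mul_assoc g, map_mul ϖ, mul_assoc, LinearMap.trace_mul_comm, mul_assoc, ← hη,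
        ← mul_assoc, ← map_mul ϖ, inv_mul_cancel_right]
    rw [Finset.sum_mul, map_sum, Finset.sum_congr rfl fun g _ => this g]
    simp
  have h1 := key s
  rw [h s, key] at h1
  exact (mul_left_cancel₀ (Nat.cast_ne_zero.2 Fintype.card_ne_zero) h1).symm

/-- If no proper nonzero subspace is invariant, symmetry of class sums can be tested against a
single operator of nonzero trace. -/
theorem ClassSym.of_irred [Fintype G] [FiniteDimensional ℂ W] {ϖ : Representation ℂ G W}
    (hirr : ∀ K : Submodule ℂ W, (∀ g, ∀ w ∈ K, ϖ g w ∈ K) → K = ⊥ ∨ K = ⊤)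
    {e : Module.End ℂ W} (he : LinearMap.trace ℂ W e ≠ 0)
    (h : ∀ s, ∑ g, LinearMap.trace ℂ W (ϖ (g * s * g⁻¹) * e) =
      ∑ g, LinearMap.trace ℂ W (ϖ (g * s⁻¹ * g⁻¹) * e)) : ClassSym ϖ := by
  intro s
  rw [← sub_eq_zero]
  have hcom : ∀ s x, ϖ x * ∑ g, ϖ (g * s * g⁻¹) = (∑ g, ϖ (g * s * g⁻¹)) * ϖ x := by
    intro s x
    rw [Finset.mul_sum, Finset.sum_mul]
    refine Fintype.sum_equiv (Equiv.mulLeft x) _ _ fun g => ?_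
    rw [← map_mul, ← map_mul, Equiv.coe_mulLeft]
    congr 1
    group
  set ζ : Module.End ℂ W := ∑ g, ϖ (g * s * g⁻¹) - ∑ g, ϖ (g * s⁻¹ * g⁻¹) with hζ
  have hζc : ∀ x, ϖ x * ζ = ζ * ϖ x := fun x => by rw [hζ, mul_sub, hcom, hcom, sub_mul]
  have hζe : LinearMap.trace ℂ W (ζ * e) = 0 := by
    rw [hζ, sub_mul, Finset.sum_mul, Finset.sum_mul, map_sub, map_sum, map_sum, h s, sub_self]
  have hnt : Nontrivial W := by
    by_contra hn
    rw [not_nontrivial_iff_subsingleton] at hn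
    exact he (by rw [Subsingleton.elim e 0, map_zero])
  obtain ⟨c, hc⟩ := Module.End.exists_eigenvalue ζ
  have hE : ζ.eigenspace c = ⊤ := by
    refine (hirr _ fun g w hw => ?_).resolve_left hc
    rw [Module.End.mem_eigenspace_iff] at hw ⊢
    rw [← Module.End.mul_apply, ← hζc, Module.End.mul_apply, hw, map_smul]
  have hζ1 : ζ = c • 1 := LinearMap.ext fun w =>
    Module.End.mem_eigenspace_iff.1 (hE ▸ Submodule.mem_top : w ∈ ζ.eigenspace c)
  rw [hζ1, smul_mul_assoc, one_mul, map_smul, smul_eq_mul] at hζe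
  rw [hζ1, (mul_eq_zero.1 hζe).resolve_right he, zero_smul]

/-- Symmetry of class sums passes to a representation with an invariant subspace `K` from the
invariant subspaces of smaller dimension. -/
theorem ClassSym.of_subRep [Fintype G] [FiniteDimensional ℂ W] {ϖ : Representation ℂ G W}
    (K : Submodule ℂ W) (hK : ∀ g, ∀ w ∈ K, ϖ g w ∈ K) (hbot : K ≠ ⊥) (htop : K ≠ ⊤)
    (h : ∀ (K : Submodule ℂ W) (hK : ∀ g, ∀ w ∈ K, ϖ g w ∈ K),
      Module.finrank ℂ K < Module.finrank ℂ W → ClassSym (subRep ϖ K hK)) : ClassSym ϖ := by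
  obtain ⟨p, hp⟩ := K.subtype.exists_leftInverse_of_injective K.ker_subtype
  have hpK : ∀ w, ∀ hw : w ∈ K, p w = ⟨w, hw⟩ := fun w hw => LinearMap.congr_fun hp ⟨w, hw⟩
  let P : Module.End ℂ W := ((Fintype.card G : ℂ)⁻¹) • ∑ g, ϖ g * (K.subtype ∘ₗ p) * ϖ g⁻¹
  have hcard : (Fintype.card G : ℂ) ≠ 0 := Nat.cast_ne_zero.2 Fintype.card_ne_zero
  have hPapp : ∀ w, P w = ((Fintype.card G : ℂ)⁻¹) • ∑ g, ϖ g (p (ϖ g⁻¹ w)) := fun w => by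
    simp [P, LinearMap.sum_apply]
  have hPmem : ∀ w, P w ∈ K := fun w => by
    rw [hPapp]
    exact K.smul_mem _ (K.sum_mem fun g _ => hK g _ (p _).2)
  have hPid : ∀ w ∈ K, P w = w := fun w hw => by
    rw [hPapp]
    simp only [hpK _ (hK _ _ hw)]
    simp only [← Module.End.mul_apply, ← map_mul, mul_inv_cancel, map_one, Module.End.one_apply]
    rw [Finset.sum_const, Finset.card_univ, ← Nat.cast_smul_eq_nsmul ℂ, smul_smul,
      inv_mul_cancel₀ hcard, one_smul]
  have hPcom : ∀ x w, P (ϖ x w) = ϖ x (P w) := fun x w => by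
    rw [hPapp, hPapp, map_smul, map_sum]
    congr 1
    refine Fintype.sum_equiv (Equiv.mulLeft x⁻¹) _ _ fun g => ?_
    simp only [Equiv.coe_mulLeft, ← Module.End.mul_apply, ← map_mul]
    rw [mul_inv_cancel_left, _root_.mul_inv_rev, inv_inv]
  have hker : ∀ g, ∀ w ∈ LinearMap.ker P, ϖ g w ∈ LinearMap.ker P := fun g w hw => by
    rw [LinearMap.mem_ker] at hw ⊢
    rw [hPcom, hw, map_zero]
  have hker_top : LinearMap.ker P ≠ ⊤ := fun h0 => by
    refine hbot ((Submodule.eq_bot_iff _).2 fun w hw => ?_)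
    rw [← hPid w hw, LinearMap.mem_ker.1 (h0 ▸ Submodule.mem_top)]
  have hsub : ∀ (K : Submodule ℂ W) (hK : ∀ g, ∀ w ∈ K, ϖ g w ∈ K), K ≠ ⊤ → ∀ s, ∀ w ∈ K,
      (∑ g, ϖ (g * s * g⁻¹)) w = (∑ g, ϖ (g * s⁻¹ * g⁻¹)) w := by
    intro K hK hne s w hw
    have h1 := congrArg Subtype.val (LinearMap.congr_fun
      (h K hK (Submodule.finrank_lt hne) s) ⟨w, hw⟩)
    simpa [LinearMap.sum_apply, subRep] using h1
  intro s
  refine LinearMap.ext fun w => ?_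
  rw [← add_sub_cancel (P w) w, map_add, map_add, hsub K hK htop s _ (hPmem w),
    hsub _ hker hker_top s (w - P w) (by
      rw [LinearMap.mem_ker, map_sub, hPid _ (hPmem w), sub_self])]

end Subrep

section Restriction

variable {F V W : Type} [Field F] [AddCommGroup V] [Module F V] [AddCommGroup W] [Module ℂ W]

/-- The linear automorphisms fixing `U` pointwise. -/
def fixer (U : Submodule F V) : Subgroup (V ≃ₗ[F] V) where
  carrier := {g | ∀ u ∈ U, g u = u}
  one_mem' := fun _ _ => rfl
  mul_mem' := fun {a b} ha hb u hu => by rw [LinearEquiv.mul_apply, hb u hu, ha u hu]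
  inv_mem' := fun {a} ha u hu => (LinearEquiv.symm_apply_eq a).2 (ha u hu).symm

theorem inv_mul_apply (g h : V ≃ₗ[F] V) (v : V) : (g⁻¹ * h) v = v ↔ h v = g v := by
  rw [LinearEquiv.mul_apply]
  exact LinearEquiv.symm_apply_eq g

theorem inv_apply_mem [FiniteDimensional F V] {U : Submodule F V} {g : V ≃ₗ[F] V}
    (hg : ∀ u ∈ U, g u ∈ U) {u : V} (hu : u ∈ U) : g⁻¹ u ∈ U := by
  obtain ⟨x, hx⟩ := (LinearMap.injective_iff_surjective (f := g.toLinearMap.restrict hg)).1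
    (fun x y h => Subtype.ext (g.injective (congrArg Subtype.val h))) ⟨u, hu⟩
  have h1 : g x = u := congrArg Subtype.val hx
  rw [← h1]
  exact (g.symm_apply_apply (x : V)).symm ▸ x.2

/-- The vectors invariant under the pointwise fixer of `U`. -/
def fixInv (ϖ : Representation ℂ (V ≃ₗ[F] V) W) (U : Submodule F V) : Submodule ℂ W where
  carrier := {w | ∀ q ∈ fixer U, ϖ q w = w}
  add_mem' := fun hv hw q hq => by rw [map_add, hv q hq, hw q hq]
  zero_mem' := fun q _ => map_zero _
  smul_mem' := fun c v hv q hq => by rw [map_smul, hv q hq]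

variable {ϖ : Representation ℂ (V ≃ₗ[F] V) W} {U : Submodule F V}

theorem rep_mul (g h : V ≃ₗ[F] V) (w : W) : ϖ (g * h) w = ϖ g (ϖ h w) := by
  rw [map_mul]; rfl

theorem apply_eq_of_mem_fixInv {w : W} (hw : w ∈ fixInv ϖ U) {g h : V ≃ₗ[F] V}
    (hgh : ∀ u ∈ U, g u = h u) : ϖ g w = ϖ h w := by
  have h1 := hw (g⁻¹ * h) fun u hu => (inv_mul_apply g h u).2 (hgh u hu).symm
  rw [← h1, ← rep_mul, mul_inv_cancel_left, h1]

theorem apply_mem_fixInv {w : W} (hw : w ∈ fixInv ϖ U) {g : V ≃ₗ[F] V}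
    (hg : ∀ u ∈ U, g u ∈ U) : ϖ g w ∈ fixInv ϖ U := by
  intro q hq
  rw [← rep_mul]
  exact apply_eq_of_mem_fixInv hw fun u hu => hq _ (hg u hu)

/-- An extension of an automorphism of the hyperplane `U`. -/
def extHyp (hU : IsHyp U) (g : U ≃ₗ[F] U) : V ≃ₗ[F] V :=
  (hU.exists_glue hU.1.choose_spec hU.1.choose_spec g).choose

theorem extHyp_apply (hU : IsHyp U) (g : U ≃ₗ[F] U) {u : V} (hu : u ∈ U) :
    extHyp hU g u = g ⟨u, hu⟩ :=
  (hU.exists_glue hU.1.choose_spec hU.1.choose_spec g).choose_spec.1 ⟨u, hu⟩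

theorem extHyp_mem (hU : IsHyp U) (g : U ≃ₗ[F] U) (u : V) (hu : u ∈ U) : extHyp hU g u ∈ U := by
  rw [extHyp_apply hU g hu]
  exact Subtype.prop _

/-- The derivative of `ϖ` along the hyperplane `U`, a representation of `GL(U)`. -/
def derivRep (ϖ : Representation ℂ (V ≃ₗ[F] V) W) (hU : IsHyp U) :
    Representation ℂ (U ≃ₗ[F] U) (fixInv ϖ U) where
  toFun g := (ϖ (extHyp hU g)).restrict fun _ hw => apply_mem_fixInv hw (extHyp_mem hU g)
  map_one' := by
    ext w
    exact w.2 _ fun u hu => extHyp_apply hU 1 hu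
  map_mul' g h := by
    ext w
    change ϖ (extHyp hU (g * h)) w = ϖ (extHyp hU g) (ϖ (extHyp hU h) w)
    rw [← rep_mul]
    refine apply_eq_of_mem_fixInv w.2 fun u hu => ?_
    rw [extHyp_apply hU _ hu, LinearEquiv.mul_apply, LinearEquiv.mul_apply, extHyp_apply hU h hu,
      extHyp_apply hU g (Subtype.prop _)]

theorem derivRep_apply (hU : IsHyp U) {g : V ≃ₗ[F] V} {g' : U ≃ₗ[F] U} (h : ∀ u : U, g u = g' u)
    (w : fixInv ϖ U) : (derivRep ϖ hU g' w : W) = ϖ g w :=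
  apply_eq_of_mem_fixInv w.2 fun u hu => by rw [extHyp_apply hU g' hu, ← h]

/-- Every nonzero vector is detected by a functional with a large stabilizer. -/
def Good (ϖ : Representation ℂ (V ≃ₗ[F] V) W) : Prop :=
  ∀ w, w ≠ 0 → ∃ ℓ : Module.Dual ℂ W, ℓ w ≠ 0 ∧ Flagged F V {g | ∀ x, ℓ (ϖ g x) = ℓ x}

theorem good_subRep (h : Good ϖ) (K : Submodule ℂ W) (hK : ∀ g, ∀ w ∈ K, ϖ g w ∈ K) :
    Good (subRep ϖ K hK) := fun w hw => by
  obtain ⟨ℓ, h1, h2⟩ := h w (fun h0 => hw (Subtype.ext h0))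
  exact ⟨ℓ ∘ₗ K.subtype, h1, h2.mono fun g hg x => hg x⟩

theorem good_derivRep (h2 : (2 : F) ≠ 0) (h : Good ϖ) (hU : IsHyp U) : Good (derivRep ϖ hU) :=
  fun w hw => by
  obtain ⟨ℓ, h1, hℓ⟩ := h w (fun h0 => hw (Subtype.ext h0))
  refine ⟨ℓ ∘ₗ (fixInv ϖ U).subtype, h1, (hℓ.restrict h2 hU).mono ?_⟩
  rintro g' ⟨g, hg, hgg⟩ x
  change ℓ (derivRep ϖ hU g' x : W) = ℓ x
  rw [derivRep_apply hU hgg, hg]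

instance fintypeEquiv [Finite V] : Fintype (V ≃ₗ[F] V) :=
  have : Finite (V ≃ₗ[F] V) := DFunLike.finite _
  Fintype.ofFinite _

/-- Class sums are symmetric in every good representation of `GL(V)`. -/
def ClassSymAll (F V : Type) [Field F] [AddCommGroup V] [Module F V] [Finite V] : Prop :=
  ∀ (W : Type) [AddCommGroup W] [Module ℂ W] [FiniteDimensional ℂ W]
    (ϖ : Representation ℂ (V ≃ₗ[F] V) W), Good ϖ → ClassSym ϖ

/-- Symmetry of traces against operators commuting with the stabilizer of a hyperplane. -/
def TraceSymAll (F V : Type) [Field F] [AddCommGroup V] [Module F V] : Prop :=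
  ∀ (W : Type) [AddCommGroup W] [Module ℂ W] [FiniteDimensional ℂ W]
    (ϖ : Representation ℂ (V ≃ₗ[F] V) W), Good ϖ → ∀ (U : Submodule F V), IsHyp U →
    ∀ η : Module.End ℂ W, (∀ g : V ≃ₗ[F] V, (∀ u ∈ U, g u ∈ U) → ϖ g * η = η * ϖ g) →
    (∀ q ∈ fixer U, ϖ q * η = η) → ∀ s, LinearMap.trace ℂ W (ϖ s * η) =
      LinearMap.trace ℂ W (ϖ s⁻¹ * η)

theorem trace_mul_eq_trace_derivRep [FiniteDimensional ℂ W] (hU : IsHyp U) {g : V ≃ₗ[F] V}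
    {g' : U ≃ₗ[F] U} (h : ∀ u : U, g u = g' u) {η : Module.End ℂ W}
    (hη : ∀ w, η w ∈ fixInv ϖ U) :
    LinearMap.trace ℂ W (ϖ g * η) =
      LinearMap.trace ℂ (fixInv ϖ U) (derivRep ϖ hU g' * η.restrict fun w _ => hη w) := by
  have hg : ∀ u ∈ U, g u ∈ U := fun u hu => h ⟨u, hu⟩ ▸ Subtype.prop _
  have hmem : ∀ w, (ϖ g * η) w ∈ fixInv ϖ U := fun w => apply_mem_fixInv (hη w) hg
  have h1 := LinearMap.trace_restrict_eq_of_forall_mem (fixInv ϖ U) (ϖ g * η) hmem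
  rw [← h1]
  refine congrArg (LinearMap.trace ℂ (fixInv ϖ U)) (LinearMap.ext fun w => Subtype.ext ?_)
  exact (derivRep_apply (ϖ := ϖ) hU h ⟨η w, hη w⟩).symm

end Restriction

section DoubleCoset

variable {F V W : Type} [Field F] [AddCommGroup V] [Module F V]
  [AddCommGroup W] [Module ℂ W] {ϖ : Representation ℂ (V ≃ₗ[F] V) W} {U : Submodule F V}
  {U₂ : Submodule F U}

/-- `x` fixes `U₂` pointwise but does not preserve `U`. -/
def Moves (U : Submodule F V) (U₂ : Submodule F U) (x : V ≃ₗ[F] V) : Prop :=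
  (∀ u ∈ U₂, x (u : V) = u) ∧ ∃ u ∈ U, x u ∉ U

theorem Moves.apply_notMem (hU₂ : IsHyp U₂) {x : V ≃ₗ[F] V} (hx : Moves U U₂ x) {u : U}
    (hu : u ∉ U₂) : x u ∉ U := by
  obtain ⟨v, hv, hxv⟩ := hx.2
  intro h
  obtain ⟨c, hc⟩ := hU₂.2 u hu ⟨v, hv⟩
  have h1 := hx.1 _ hc
  refine hxv ?_
  have h2 : x v = ((⟨v, hv⟩ - c • u : U) : V) + c • x u := by
    rw [← h1]; simp
  rw [h2]
  exact U.add_mem (Subtype.prop _) (U.smul_mem _ h)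

theorem Moves.operator_eq (hU : IsHyp U) (hU₂ : IsHyp U₂) {x y : V ≃ₗ[F] V} (hx : Moves U U₂ x)
    (hy : Moves U U₂ y) {e η : Module.End ℂ W} (he : ∀ q ∈ fixer U, e * ϖ q = e)
    (hη : ∀ q ∈ fixer U, ϖ q * η = η) : e * ϖ x * η = e * ϖ y * η := by
  obtain ⟨u, hu⟩ := hU₂.1
  obtain ⟨q, hq, hqx⟩ := hU.exists_glue (hx.apply_notMem hU₂ hu) (hy.apply_notMem hU₂ hu) 1
  have hq' : q ∈ fixer U := fun v hv => hq ⟨v, hv⟩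
  have hp : y⁻¹ * (q * x) ∈ fixer U := by
    intro v hv
    rw [inv_mul_apply, LinearEquiv.mul_apply]
    obtain ⟨c, hc⟩ := hU₂.2 u hu ⟨v, hv⟩
    have h1 := hx.1 _ hc
    have h2 : v = ((⟨v, hv⟩ - c • u : U) : V) + c • (u : V) := by simp
    rw [h2, map_add, map_add, map_add, h1, hq' _ (Subtype.prop _), hy.1 _ hc, map_smul, map_smul,
      map_smul, hqx]
  have h1 : e * ϖ x = e * ϖ (q * x) := by rw [map_mul, ← mul_assoc, he q hq']
  rw [h1, ← mul_inv_cancel_left y (q * x), map_mul ϖ y, ← mul_assoc, mul_assoc _ _ η, hη _ hp]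

theorem Moves.inv [FiniteDimensional F V] {x : V ≃ₗ[F] V} (hx : Moves U U₂ x) : Moves U U₂ x⁻¹ := by
  refine ⟨fun u hu => (LinearEquiv.symm_apply_eq x).2 (hx.1 u hu).symm, ?_⟩
  by_contra! h
  obtain ⟨u, hu, hxu⟩ := hx.2
  exact hxu (by simpa using inv_apply_mem h hu)

theorem Moves.conj [FiniteDimensional F V] {x : V ≃ₗ[F] V} (hx : Moves U U₂ x) {y : V ≃ₗ[F] V}
    {y' : U ≃ₗ[F] U} (hy : ∀ u : U, y u = y' u) (hy' : ∀ u ∈ U₂, y' u ∈ U₂) :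
    Moves U U₂ (y * x * y⁻¹) := by
  have hyU : ∀ u ∈ U, y u ∈ U := fun u hu => hy ⟨u, hu⟩ ▸ Subtype.prop _
  refine ⟨fun u hu => ?_, ?_⟩
  · have h1 : y⁻¹ (u : V) = (y'⁻¹ u : U) :=
      (LinearEquiv.symm_apply_eq y).2 (by rw [hy]; exact congrArg _ (y'.apply_symm_apply u).symm)
    rw [LinearEquiv.mul_apply, LinearEquiv.mul_apply, h1, hx.1 _ (inv_apply_mem hy' hu), ← h1]
    exact y.apply_symm_apply _
  · obtain ⟨u, hu, hxu⟩ := hx.2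
    refine ⟨y u, hyU u hu, fun h => hxu ?_⟩
    have h1 := inv_apply_mem hyU h
    simpa [LinearEquiv.mul_apply] using h1

theorem Moves.mul {x : V ≃ₗ[F] V} (hx : Moves U U₂ x) {q : V ≃ₗ[F] V}
    (hqU : ∀ u ∈ U, q⁻¹ u ∈ U) (hq : ∀ u ∈ U₂, q (u : V) = u) : Moves U U₂ (q * x) := by
  refine ⟨fun u hu => by rw [LinearEquiv.mul_apply, hx.1 u hu, hq u hu], ?_⟩
  obtain ⟨u, hu, hxu⟩ := hx.2
  refine ⟨u, hu, fun h => hxu ?_⟩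
  simpa [LinearEquiv.mul_apply] using hqU _ h

end DoubleCoset

section LStep

variable {F V W : Type} [Field F] [AddCommGroup V] [Module F V]
  [AddCommGroup W] [Module ℂ W] {ϖ : Representation ℂ (V ≃ₗ[F] V) W} {U : Submodule F V}

theorem exists_restrict [FiniteDimensional F V] {g : V ≃ₗ[F] V} (hg : ∀ u ∈ U, g u ∈ U) :
    ∃ g' : U ≃ₗ[F] U, ∀ u : U, g u = g' u :=
  ⟨LinearEquiv.ofInjectiveEndo (g.toLinearMap.restrict hg)
    (fun _ _ h => Subtype.ext (g.injective (congrArg Subtype.val h))), fun _ => rfl⟩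

theorem inv_restrict {g : V ≃ₗ[F] V} {g' : U ≃ₗ[F] U} (h : ∀ u : U, g u = g' u) (u : U) :
    g⁻¹ (u : V) = (g'⁻¹ u : U) :=
  (LinearEquiv.symm_apply_eq g).2 (by rw [h]; exact congrArg _ (g'.apply_symm_apply u).symm)

theorem derivRep_commute (hU : IsHyp U) {η : Module.End ℂ W} (hη : ∀ w, η w ∈ fixInv ϖ U)
    {g : V ≃ₗ[F] V} {g' : U ≃ₗ[F] U} (h : ∀ u : U, g u = g' u) (hg : ϖ g * η = η * ϖ g) :
    derivRep ϖ hU g' * η.restrict (fun w _ => hη w : ∀ w ∈ fixInv ϖ U, _) =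
      η.restrict (fun w _ => hη w : ∀ w ∈ fixInv ϖ U, _) * derivRep ϖ hU g' := by
  refine LinearMap.ext fun w => Subtype.ext ?_
  have h1 := derivRep_apply (ϖ := ϖ) hU h ⟨η w, hη w⟩
  refine h1.trans ((LinearMap.congr_fun hg (w : W)).trans ?_)
  exact congrArg η (derivRep_apply (ϖ := ϖ) hU h w).symm

theorem trace_symm_of_preserves [FiniteDimensional ℂ W] [FiniteDimensional F V] [Finite U]
    (h2 : (2 : F) ≠ 0) (hU : IsHyp U) (h : ClassSymAll F U) (hϖ : Good ϖ) {η : Module.End ℂ W}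
    (hc : ∀ g : V ≃ₗ[F] V, (∀ u ∈ U, g u ∈ U) → ϖ g * η = η * ϖ g)
    (hη : ∀ w, η w ∈ fixInv ϖ U) {s : V ≃ₗ[F] V} (hs : ∀ u ∈ U, s u ∈ U) :
    LinearMap.trace ℂ W (ϖ s * η) = LinearMap.trace ℂ W (ϖ s⁻¹ * η) := by
  obtain ⟨s', hs'⟩ := exists_restrict hs
  rw [trace_mul_eq_trace_derivRep hU hs' hη,
    trace_mul_eq_trace_derivRep hU (inv_restrict hs') hη]
  exact (h _ _ (good_derivRep h2 hϖ hU)).trace_eq (fun g' => derivRep_commute hU hη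
    (fun u => extHyp_apply hU g' u.2) (hc _ (extHyp_mem hU g'))) s'

theorem exists_moves [FiniteDimensional F V] (hU : IsHyp U) {s : V ≃ₗ[F] V}
    (hs : ∃ u ∈ U, s u ∉ U) : ∃ (U₂ : Submodule F U) (s' : U ≃ₗ[F] U),
      IsHyp U₂ ∧ Moves U U₂ ((extHyp hU s')⁻¹ * s) := by
  have h1 : IsHyp ((U.comap s.toLinearMap).comap U.subtype) := by
    refine (hU.comap_equiv s).comap_subtype fun h => ?_
    obtain ⟨u, hu, hsu⟩ := hs
    exact hsu (h hu)
  obtain ⟨s', hs'⟩ := exists_extend_injective (U := (U.comap s.toLinearMap).comap U.subtype)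
    ((s.toLinearMap ∘ₗ U.subtype).restrict (p := (U.comap s.toLinearMap).comap U.subtype)
      (q := U) fun u hu => hu)
    (fun x y h => Subtype.ext (Subtype.ext (s.injective (congrArg Subtype.val h))))
  refine ⟨_, s', h1, fun u hu => ?_, ?_⟩
  · rw [inv_mul_apply, extHyp_apply hU s' u.2, hs' ⟨u, hu⟩]
    rfl
  · obtain ⟨u, hu, hsu⟩ := hs
    refine ⟨u, hu, fun h => hsu ?_⟩
    have := extHyp_mem hU s' _ h
    rw [← LinearEquiv.mul_apply, mul_inv_cancel_left] at this
    exact this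

theorem mul_eigenProj_fixer [Finite V] {q : V ≃ₗ[F] V} (hq : q ∈ fixer U) :
    ϖ q * eigenProj ϖ (fixer U) 1 = eigenProj ϖ (fixer U) 1 := by
  simpa using mul_eigenProj (ϖ := ϖ) (χ := 1) (⟨q, hq⟩ : fixer U)

theorem eigenProj_fixer_mul [Finite V] {q : V ≃ₗ[F] V} (hq : q ∈ fixer U) :
    eigenProj ϖ (fixer U) 1 * ϖ q = eigenProj ϖ (fixer U) 1 := by
  simpa using eigenProj_mul (ϖ := ϖ) (χ := 1) (⟨q, hq⟩ : fixer U)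

theorem eigenProj_fixer_mem [Finite V] (w : W) : eigenProj ϖ (fixer U) 1 w ∈ fixInv ϖ U :=
  fun _ hq => LinearMap.congr_fun (mul_eigenProj_fixer hq) w

theorem eigenProj_fixer_comm [Finite V] [FiniteDimensional F V] {g : V ≃ₗ[F] V}
    (hg : ∀ u ∈ U, g u ∈ U) :
    ϖ g * eigenProj ϖ (fixer U) 1 = eigenProj ϖ (fixer U) 1 * ϖ g := by
  have h1 : eigenProj ϖ (fixer U) 1 * (ϖ g * eigenProj ϖ (fixer U) 1) =
      ϖ g * eigenProj ϖ (fixer U) 1 := eigenProj_mul_of_eigen fun k => by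
    rw [MonoidHom.one_apply, one_smul]
    exact LinearMap.ext fun w => apply_mem_fixInv (eigenProj_fixer_mem w) hg k k.2
  have h3 : (eigenProj ϖ (fixer U) 1 * ϖ g) * eigenProj ϖ (fixer U) 1 =
      eigenProj ϖ (fixer U) 1 * ϖ g := mul_eigenProj_of_eigen fun k => by
    have hk : g * k * g⁻¹ ∈ fixer U := fun u hu => by
      rw [LinearEquiv.mul_apply, LinearEquiv.mul_apply, k.2 _ (inv_apply_mem hg hu)]
      exact g.apply_symm_apply u
    have hgk : g * k = g * k * g⁻¹ * g := (inv_mul_cancel_right _ _).symm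
    rw [MonoidHom.one_apply, one_smul, mul_assoc, ← map_mul ϖ, hgk, map_mul ϖ, ← mul_assoc,
      eigenProj_fixer_mul hk]
  rw [← h1, ← mul_assoc, h3]

theorem TraceSymAll.of_hyp [Finite V] [FiniteDimensional F V] (h2 : (2 : F) ≠ 0)
    (h : ∀ U : Submodule F V, IsHyp U → ClassSymAll F U ∧ TraceSymAll F U) :
    TraceSymAll F V := by
  intro W _ _ _ ϖ hϖ U hU η hc hq s
  have hη : ∀ w, η w ∈ fixInv ϖ U := fun w q hqU => LinearMap.congr_fun (hq q hqU) w
  by_cases hs : ∀ u ∈ U, s u ∈ U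
  · exact trace_symm_of_preserves h2 hU (h U hU).1 hϖ hc hη hs
  push Not at hs
  obtain ⟨U₂, s', hU₂, hx⟩ := exists_moves hU hs
  set y := extHyp hU s' with hy
  have hyU : ∀ u : U, y u = s' u := fun u => extHyp_apply hU s' u.2
  set x := y⁻¹ * s with hxdef
  have hsx : s = y * x := by rw [hxdef, mul_inv_cancel_left]
  have hqU : ∀ q ∈ fixer U, ∀ u ∈ U, q u ∈ U := fun q hq u hu => (hq u hu).symm ▸ hu
  let e : Module.End ℂ W := eigenProj ϖ (fixer U) 1
  have heη : e * η = η := eigenProj_mul_of_eigen fun k => by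
    rw [hq k k.2, MonoidHom.one_apply, one_smul]
  have hηe : η * e = η := mul_eigenProj_of_eigen fun k => by
    rw [← hc k (hqU k k.2), hq k k.2, MonoidHom.one_apply, one_smul]
  have heq : ∀ q ∈ fixer U, e * ϖ q = e := fun q hq => eigenProj_fixer_mul hq
  have hemem : ∀ w, e w ∈ fixInv ϖ U := eigenProj_fixer_mem
  have hcomm : ∀ g : V ≃ₗ[F] V, (∀ u ∈ U, g u ∈ U) → ϖ g * e = e * ϖ g := fun g hg =>
    eigenProj_fixer_comm hg
  let η' : Module.End ℂ W := e * ϖ x * η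
  have hη' : ∀ w, η' w ∈ fixInv ϖ U := fun w => hemem _
  have hyU' : ∀ u ∈ U, y u ∈ U := extHyp_mem hU s'
  have hmain : ∀ {g z : V ≃ₗ[F] V}, (∀ u ∈ U, g u ∈ U) → e * ϖ z * η = η' →
      LinearMap.trace ℂ W (ϖ (g * z) * η) = LinearMap.trace ℂ W (ϖ g * η') := by
    intro g z hg hz
    rw [← hz, ← mul_assoc, ← mul_assoc, hcomm g hg, mul_assoc e, ← map_mul ϖ, mul_assoc,
      LinearMap.trace_mul_comm ℂ e, mul_assoc, hηe]
  have hxi : e * ϖ x⁻¹ * η = η' := hx.inv.operator_eq hU hU₂ hx heq hq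
  have hsi : LinearMap.trace ℂ W (ϖ s⁻¹ * η) = LinearMap.trace ℂ W (ϖ (y⁻¹ * x⁻¹) * η) := by
    rw [hsx, _root_.mul_inv_rev, map_mul ϖ, mul_assoc, hc y⁻¹ fun u hu => inv_apply_mem hyU' hu,
      ← mul_assoc, LinearMap.trace_mul_comm, ← mul_assoc, ← map_mul ϖ]
  rw [hsi, hmain (fun u hu => inv_apply_mem hyU' hu) hxi, hsx, hmain hyU' rfl,
    trace_mul_eq_trace_derivRep hU hyU hη',
    trace_mul_eq_trace_derivRep hU (inv_restrict hyU) hη']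
  refine (h U hU).2 _ _ (good_derivRep h2 hϖ hU) U₂ hU₂ _ (fun g' hg' => ?_) (fun q' hq' => ?_) s'
  · have hg : ∀ u : U, extHyp hU g' u = g' u := fun u => extHyp_apply hU g' u.2
    refine derivRep_commute hU hη' hg ?_
    change ϖ _ * (e * ϖ x * η) = e * ϖ x * η * ϖ _
    set g := extHyp hU g'
    have hgU : ∀ u ∈ U, g u ∈ U := extHyp_mem hU g'
    have hgx : g * x = g * x * g⁻¹ * g := (inv_mul_cancel_right _ _).symm
    rw [← mul_assoc, ← mul_assoc, hcomm g hgU, mul_assoc e, ← map_mul ϖ, hgx, map_mul ϖ _ g,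
      ← mul_assoc, mul_assoc _ (ϖ g), hc g hgU, ← mul_assoc,
      (hx.conj hg hg').operator_eq hU hU₂ hx heq hq]
  · have hg : ∀ u : U, extHyp hU q' u = q' u := fun u => extHyp_apply hU q' u.2
    refine LinearMap.ext fun w => Subtype.ext ?_
    refine (derivRep_apply (ϖ := ϖ) hU hg ⟨η' w, hη' w⟩).trans ?_
    change (ϖ (extHyp hU q') * (e * ϖ x * η)) w = (e * ϖ x * η) w
    set g := extHyp hU q'
    have hgU : ∀ u ∈ U, g u ∈ U := extHyp_mem hU q'
    have hm : Moves U U₂ (g * x) := hx.mul (fun u hu => inv_apply_mem hgU hu) fun u hu => by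
      rw [hg, hq' u hu]
    rw [← mul_assoc, ← mul_assoc, hcomm g hgU, mul_assoc e, ← map_mul ϖ,
      hm.operator_eq hU hU₂ hx heq hq]

end LStep

section Fourier

variable {F V : Type} [Field F] [AddCommGroup V] [Module F V]

/-- The endomorphisms mapping the image of `p` to its kernel and vanishing on its kernel. -/
def offDiag (p : Module.End F V) : AddSubgroup (Module.End F V) where
  carrier := {z | p * z = 0 ∧ z * p = z}
  add_mem' := fun {a b} ha hb => ⟨by rw [mul_add, ha.1, hb.1, add_zero],
    by rw [add_mul, ha.2, hb.2]⟩
  zero_mem' := ⟨mul_zero _, zero_mul _⟩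
  neg_mem' := fun {a} ha => ⟨by rw [mul_neg, ha.1, neg_zero], by rw [neg_mul, ha.2]⟩

theorem mem_offDiag {p z : Module.End F V} : z ∈ offDiag p ↔ p * z = 0 ∧ z * p = z := Iff.rfl

theorem mul_eq_zero_of_offDiag {p z z' : Module.End F V} (hz : z ∈ offDiag p)
    (hz' : z' ∈ offDiag p) : z * z' = 0 := by
  rw [← hz.2, mul_assoc, hz'.1, mul_zero]

/-- The unipotent automorphism `1 + z`. -/
def oneAdd {p : Module.End F V} (z : offDiag p) : V ≃ₗ[F] V :=
  LinearEquiv.ofLinearMap (1 + z : Module.End F V) (1 - z : Module.End F V)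
    (by
      change (1 + z : Module.End F V) * (1 - z) = 1
      rw [mul_sub, mul_one, add_mul, one_mul, mul_eq_zero_of_offDiag z.2 z.2]; simp)
    (by
      change (1 - z : Module.End F V) * (1 + z) = 1
      rw [mul_add, mul_one, sub_mul, one_mul, mul_eq_zero_of_offDiag z.2 z.2]; simp)

theorem coe_oneAdd {p : Module.End F V} (z : offDiag p) :
    ((oneAdd z : V ≃ₗ[F] V) : Module.End F V) = 1 + z := rfl

theorem coe_mul (g h : V ≃ₗ[F] V) :
    ((g * h : V ≃ₗ[F] V) : Module.End F V) = (g : Module.End F V) * (h : Module.End F V) := rfl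

theorem coe_mul_coe_inv (g : V ≃ₗ[F] V) :
    (g : Module.End F V) * ((g⁻¹ : V ≃ₗ[F] V) : Module.End F V) = 1 := by
  rw [← coe_mul, mul_inv_cancel]; rfl

theorem coe_inv_mul_coe (g : V ≃ₗ[F] V) :
    ((g⁻¹ : V ≃ₗ[F] V) : Module.End F V) * (g : Module.End F V) = 1 := by
  rw [← coe_mul, inv_mul_cancel]; rfl

theorem coe_injective {g h : V ≃ₗ[F] V} (H : (g : Module.End F V) = (h : Module.End F V)) :
    g = h := LinearEquiv.toLinearMap_injective H

theorem oneAdd_add {p : Module.End F V} (z z' : offDiag p) :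
    oneAdd (z + z') = oneAdd z * oneAdd z' := by
  refine coe_injective ?_
  rw [coe_mul, coe_oneAdd, coe_oneAdd, coe_oneAdd, mul_add, add_mul, add_mul,
    mul_eq_zero_of_offDiag z.2 z'.2]
  simp [add_assoc]

/-- The trace pairing between the two off-diagonal blocks is nondegenerate. -/
theorem exists_trace_eq [FiniteDimensional F V] {p : Module.End F V} (hp : p * p = p)
    {z : Module.End F V} (hz : z ∈ offDiag p) (h0 : z ≠ 0) (c : F) :
    ∃ k ∈ offDiag (1 - p), LinearMap.trace F V (k * z) = c := by
  obtain ⟨v, hv⟩ : ∃ v, z v ≠ 0 := by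
    by_contra! h
    exact h0 (LinearMap.ext h)
  obtain ⟨φ, hφ⟩ : ∃ φ : Module.Dual F V, φ (z v) = c := by
    obtain ⟨φ, hφ⟩ : ∃ φ : Module.Dual F V, φ (z v) ≠ 0 := by
      by_contra! h
      exact hv ((Module.forall_dual_apply_eq_zero_iff F _).1 h)
    exact ⟨(c / φ (z v)) • φ, by simp [hφ]⟩
  have h1 : (1 - p) * p = 0 := by rw [sub_mul, one_mul, hp, sub_self]
  have h2 : (1 - p) * (1 - p) = 1 - p := by rw [mul_sub, h1, mul_one, sub_zero]
  have h3 : (1 - p) * z = z := by rw [sub_mul, one_mul, hz.1, sub_zero]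
  refine ⟨p * φ.smulRight v * (1 - p), ⟨?_, ?_⟩, ?_⟩
  · rw [← mul_assoc, ← mul_assoc, h1, zero_mul, zero_mul]
  · rw [mul_assoc, h2]
  · rw [mul_assoc, h3, mul_assoc, LinearMap.trace_mul_comm, mul_assoc, hz.2]
    change LinearMap.trace F V (φ.smulRight v ∘ₗ z) = c
    have : φ.smulRight v ∘ₗ z = (φ ∘ₗ z).smulRight v := rfl
    rw [this, LinearMap.trace_smulRight]
    exact hφ

variable {W : Type} [AddCommGroup W] [Module ℂ W] {ϖ : Representation ℂ (V ≃ₗ[F] V) W}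

/-- A Fourier coefficient of an invariant functional along the off-diagonal block. -/
theorem exists_fourier_coeff [Finite V] [Finite F] [FiniteDimensional F V] {ψ : AddChar F ℂ}
    (hψ : ∃ a, ψ a ≠ 1) {p : Module.End F V} (hp : p * p = p) {ℓ : Module.Dual ℂ W} (hℓ0 : ℓ ≠ 0)
    (hℓ : ∀ g : V ≃ₗ[F] V, p * g = g * p → ∀ w, ℓ (ϖ g w) = ℓ w) :
    ∃ k : Module.End F V, k ∈ offDiag (1 - p) ∧ ∃ ℓ' : Module.Dual ℂ W, ℓ' ≠ 0 ∧
      (∀ (z : offDiag p) w, ℓ' (ϖ (oneAdd z) w) = ψ (LinearMap.trace F V (k * z)) * ℓ' w) ∧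
      ∀ m : V ≃ₗ[F] V, p * m = m * p → k * m = m * k → ∀ w, ℓ' (ϖ m w) = ℓ' w := by
  have : Finite (Module.End F V) := DFunLike.finite _
  have := Fintype.ofFinite (offDiag p)
  have := Fintype.ofFinite (offDiag (1 - p))
  let c (k : Module.End F V) : Module.Dual ℂ W :=
    ∑ z : offDiag p, ψ (-LinearMap.trace F V (k * z)) • (ℓ ∘ₗ ϖ (oneAdd z))
  have hc (k) (w) : c k w = ∑ z : offDiag p, ψ (-LinearMap.trace F V (k * z)) * ℓ
      (ϖ (oneAdd z) w) := by
    simp [c, LinearMap.sum_apply]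
  obtain ⟨k, hk⟩ : ∃ k : offDiag (1 - p), c k ≠ 0 := by
    by_contra! h
    have h1 : ∑ k : offDiag (1 - p), c k = (Fintype.card (offDiag (1 - p)) : ℂ) • ℓ := by
      simp only [c]
      rw [Finset.sum_comm, Finset.sum_eq_single 0]
      · have h0 : oneAdd (0 : offDiag p) = 1 := coe_injective (by simp [coe_oneAdd]; rfl)
        simp only [ZeroMemClass.coe_zero, mul_zero, map_zero, neg_zero, AddChar.map_zero_eq_one,
            one_smul,
          h0, map_one ϖ]
        rw [Finset.sum_const, Finset.card_univ, ← Nat.cast_smul_eq_nsmul ℂ]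
        rfl
      · intro z _ hz
        rw [← Finset.sum_smul]
        obtain ⟨a, ha⟩ := hψ
        obtain ⟨k₀, hk₀, hk₀a⟩ := exists_trace_eq hp z.2 (fun h => hz (Subtype.ext h)) (-a)
        let χ : AddChar (offDiag (1 - p)) ℂ :=
          { toFun := fun k => ψ (-LinearMap.trace F V (k * z))
            map_zero_eq_one' := by simp
            map_add_eq_mul' := fun a b => by
              rw [← AddChar.map_add_eq_mul]; simp [add_mul, add_comm] }
        have hχ : χ ≠ 1 := fun h => by
          have := DFunLike.congr_fun h ⟨k₀, hk₀⟩
          change ψ (-LinearMap.trace F V (k₀ * z)) = 1 at this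
          rw [hk₀a, neg_neg] at this
          exact ha this
        have := AddChar.sum_eq_zero_of_ne_one hχ
        change ∑ k, χ k = 0 at this
        change (∑ k, χ k) • _ = _
        rw [this, zero_smul]
      · simp
    rw [Finset.sum_eq_zero fun k _ => h k, eq_comm, smul_eq_zero] at h1
    exact hℓ0 (h1.resolve_left (Nat.cast_ne_zero.2 Fintype.card_ne_zero))
  refine ⟨k, k.2, c k, hk, fun z w => ?_, fun m hm hkm w => ?_⟩
  · rw [hc, hc, Finset.mul_sum]
    refine Fintype.sum_equiv (Equiv.addRight z) _ _ fun x => ?_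
    rw [← mul_assoc, Equiv.coe_addRight, oneAdd_add, rep_mul, ← AddChar.map_add_eq_mul]
    congr 2
    simp [mul_add]
  · rw [hc, hc]
    have hmi : p * ((m⁻¹ : V ≃ₗ[F] V) : Module.End F V) = (m⁻¹ : V ≃ₗ[F] V) * p :=
      commute_inv (coe_mul_coe_inv m) hm
    let τ (g : V ≃ₗ[F] V) (hg : p * (g : Module.End F V) = g * p)
        (hg' : p * ((g⁻¹ : V ≃ₗ[F] V) : Module.End F V) = (g⁻¹ : V ≃ₗ[F] V) * p) (z : offDiag p) :
            offDiag p :=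
      ⟨(g⁻¹ : V ≃ₗ[F] V) * (z : Module.End F V) * (g : Module.End F V), by
        rw [mem_offDiag, mul_assoc _ _ p, ← hg, ← mul_assoc, ← mul_assoc, hg', mul_assoc _ p, z.2.1,
          ← mul_assoc, mul_assoc _ _ p, z.2.2]
        simp⟩
    let E : offDiag p ≃ offDiag p :=
      { toFun := τ m hm hmi
        invFun := τ m⁻¹ hmi (by rw [inv_inv]; exact hm)
        left_inv := fun z => Subtype.ext (by
          simp only [τ, inv_inv]
          rw [← mul_assoc, ← mul_assoc, coe_mul_coe_inv, one_mul, mul_assoc, coe_mul_coe_inv,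
              mul_one])
        right_inv := fun z => Subtype.ext (by
          simp only [τ, inv_inv]
          rw [← mul_assoc, ← mul_assoc, coe_inv_mul_coe, one_mul, mul_assoc, coe_inv_mul_coe,
              mul_one]) }
    refine Fintype.sum_equiv E _ _ fun z => ?_
    have h1 : oneAdd z * m = m * oneAdd (E z) := by
      refine coe_injective ?_
      change (1 + (z : Module.End F V)) * m = m * (1 + (m⁻¹ : V ≃ₗ[F] V) * (z : Module.End F V) * m)
      rw [mul_add, ← mul_assoc, ← mul_assoc, coe_mul_coe_inv]
      simp [add_mul]
    have h2 : LinearMap.trace F V ((k : Module.End F V) * (E z : offDiag p)) =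
        LinearMap.trace F V ((k : Module.End F V) * z) := by
      change LinearMap.trace F V ((k : Module.End F V) *
          ((m⁻¹ : V ≃ₗ[F] V) * (z : Module.End F V) * m)) = _
      rw [LinearMap.trace_mul_comm, mul_assoc, ← hkm, LinearMap.trace_mul_comm, mul_assoc,
          ← mul_assoc (m : Module.End F V),
        coe_mul_coe_inv, one_mul]
    rw [h2, ← rep_mul, h1, rep_mul, hℓ m hm]

end Fourier

section Nondegenerate

variable {F V : Type} [Field F] [AddCommGroup V] [Module F V]

theorem block_mul_block {p q q' : Module.End F V} (hp : p * p = p) (hqq' : q * q' = 1)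
    (hq : q * (1 - p) = 1 - p) : (p * q * p + (1 - p)) * (p * q' * p + (1 - p)) = 1 := by
  have h1 : p * (1 - p) = 0 := by rw [mul_sub, mul_one, hp, sub_self]
  have h2 : (1 - p) * p = 0 := by rw [sub_mul, one_mul, hp, sub_self]
  have h3 : (1 - p) * (1 - p) = 1 - p := by rw [mul_sub, h2, mul_one, sub_zero]
  calc (p * q * p + (1 - p)) * (p * q' * p + (1 - p))
      = p * q * (p * p) * q' * p + p * q * (p * (1 - p)) + ((1 - p) * p) * q' * p
        + (1 - p) * (1 - p) := by noncomm_ring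
    _ = p * (q * q') * p - p * (q * (1 - p)) * q' * p + (1 - p) := by
      rw [hp, h1, h2, h3]; noncomm_ring
    _ = 1 := by rw [hqq', hq, mul_one, hp, h1]; noncomm_ring

variable {W : Type} [AddCommGroup W] [Module ℂ W] {ϖ : Representation ℂ (V ≃ₗ[F] V) W}

theorem apply_eq_zero_of_comp_eq_zero [FiniteDimensional F V] {ψ : AddChar F ℂ}
    {p k : Module.End F V} (hp : p * p = p) (hk : k ∈ offDiag (1 - p)) {ℓ : Module.Dual ℂ W}
    (hℓ0 : ℓ ≠ 0)
    (hz : ∀ (z : offDiag p) w, ℓ (ϖ (oneAdd z) w) = ψ (LinearMap.trace F V (k * z)) * ℓ w)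
    (hm : ∀ m : V ≃ₗ[F] V, p * m = m * p → k * m = m * k → ∀ w, ℓ (ϖ m w) = ℓ w)
    (hno : ∀ U : Submodule F V, IsHyp U → ∀ ℓ : Module.Dual ℂ W,
      (∀ q ∈ fixer U, ∀ w, ℓ (ϖ q w) = ℓ w) → ℓ = 0)
    {φ : Module.Dual F V} (hφ : ∀ v, φ (k v) = 0) (v : V) : φ (p v) = 0 := by
  by_contra h0
  have hφp : φ ∘ₗ p ≠ 0 := fun h => h0 (LinearMap.congr_fun h v)
  have h1 : p * (1 - p) = 0 := by rw [mul_sub, mul_one, hp, sub_self]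
  have h2 : (1 - p) * p = 0 := by rw [sub_mul, one_mul, hp, sub_self]
  have hpk : p * k = k := by
    have := hk.1
    rwa [sub_mul, one_mul, sub_eq_zero, eq_comm] at this
  have hkp : k * p = 0 := by
    have := hk.2
    rwa [mul_sub, mul_one, sub_eq_self] at this
  refine hℓ0 (hno _ (isHyp_ker hφp) ℓ fun q hq w => ?_)
  have hfix : ∀ q ∈ fixer (LinearMap.ker (φ ∘ₗ p)), ∀ a : Module.End F V,
      (∀ v, φ (p (a v)) = 0) → (q : Module.End F V) * a = a := fun q hq a ha =>
    LinearMap.ext fun v => hq (a v) (ha v)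
  have hk0 : ∀ v, φ (p (k v)) = 0 := fun v => by
    rw [← Module.End.mul_apply, hpk, hφ]
  have hp0 : ∀ v, φ (p ((1 - p) v)) = 0 := fun v => by
    rw [← Module.End.mul_apply, h1, LinearMap.zero_apply, map_zero]
  have hqp := hfix q hq _ hp0
  have hqk := hfix q hq _ hk0
  have hqp' := hfix q⁻¹ ((fixer _).inv_mem hq) _ hp0
  let m : V ≃ₗ[F] V := LinearEquiv.ofLinearMap (p * (q : Module.End F V) * p + (1 - p))
    (p * ((q⁻¹ : V ≃ₗ[F] V) : Module.End F V) * p + (1 - p))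
    (block_mul_block hp (coe_mul_coe_inv q) hqp) (block_mul_block hp (coe_inv_mul_coe q) hqp')
  have hm0 : (m : Module.End F V) = p * (q : Module.End F V) * p + (1 - p) := rfl
  have hmp : p * (m : Module.End F V) = m * p := by
    rw [hm0, mul_add, add_mul, h1, h2, add_zero, add_zero, mul_assoc _ p p, hp, ← mul_assoc,
      ← mul_assoc, hp]
  have hmk : k * (m : Module.End F V) = m * k := by
    rw [hm0, mul_add, ← mul_assoc, ← mul_assoc, hkp, hk.2, zero_mul, zero_mul, zero_add, add_mul,
      hk.1, add_zero, mul_assoc, hpk, mul_assoc, hqk, hpk]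
  let z : offDiag p := ⟨(1 - p) * (q : Module.End F V) * p, by
    rw [← mul_assoc, ← mul_assoc, h1, zero_mul, zero_mul], by rw [mul_assoc, hp]⟩
  have hqm : q = m * oneAdd z := by
    refine coe_injective ?_
    rw [coe_mul, coe_oneAdd, hm0]
    change (q : Module.End F V) = (p * (q : Module.End F V) * p + (1 - p)) *
      (1 + (1 - p) * (q : Module.End F V) * p)
    calc (q : Module.End F V) = q * (1 - p) + q * p := by noncomm_ring
      _ = (1 - p) + p * q * p + (1 - p) * q * p := by rw [hqp]; noncomm_ring
      _ = p * q * p + (1 - p) + p * q * (p * (1 - p)) * q * p + (1 - p) * q * p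
          - (p * (1 - p)) * q * p := by
        rw [h1]; simp only [mul_zero, zero_mul, add_zero, sub_zero]; abel
      _ = _ := by noncomm_ring
  have htr : LinearMap.trace F V (k * z) = 0 := by
    change LinearMap.trace F V (k * ((1 - p) * (q : Module.End F V) * p)) = 0
    rw [← mul_assoc, ← mul_assoc, hk.2, LinearMap.trace_mul_comm, ← mul_assoc, hpk,
      LinearMap.trace_mul_comm, hqk, ← hpk, LinearMap.trace_mul_comm, hkp, map_zero]
  rw [hqm, rep_mul, hm m hmp hmk, hz, htr, AddChar.map_zero_eq_one, one_mul]

theorem exists_mul_eq_of_comp_eq_zero [FiniteDimensional F V] {p k : Module.End F V}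
    (h : ∀ φ : Module.Dual F V, (∀ v, φ (k v) = 0) → ∀ v, φ (p v) = 0) :
    ∃ a : Module.End F V, k * a = p := by
  have hle : LinearMap.range p ≤ LinearMap.range k := by
    rintro _ ⟨v, rfl⟩
    by_contra hv
    obtain ⟨φ, hφ, hker⟩ := Submodule.exists_le_ker_of_notMem hv
    exact hφ (h φ (fun x => hker ⟨x, rfl⟩) v)
  obtain ⟨j, hj⟩ := k.rangeRestrict.exists_rightInverse_of_surjective k.range_rangeRestrict
  refine ⟨j ∘ₗ p.codRestrict (LinearMap.range k) fun v => hle ⟨v, rfl⟩, LinearMap.ext fun v => ?_⟩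
  exact congrArg Subtype.val (LinearMap.congr_fun hj ⟨p v, hle ⟨v, rfl⟩⟩)

/-- A functional invariant under the centralizer of a projection yields a contracting homotopy
with a character of the centralizer of the corresponding nilpotent. -/
theorem exists_homotopy_functional [Finite V] [Finite F] [FiniteDimensional F V] {ψ : AddChar F ℂ}
    (hψ : ∃ a, ψ a ≠ 1) {p : Module.End F V} (hp : p * p = p) {ℓ : Module.Dual ℂ W} (hℓ0 : ℓ ≠ 0)
    (hℓ : ∀ g : V ≃ₗ[F] V, p * g = g * p → ∀ w, ℓ (ϖ g w) = ℓ w)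
    (hno : ∀ U : Submodule F V, IsHyp U → ∀ ℓ : Module.Dual ℂ W,
      (∀ q ∈ fixer U, ∀ w, ℓ (ϖ q w) = ℓ w) → ℓ = 0) :
    ∃ ν k : Module.End F V, k * ν = p ∧ ν * k = 1 - p ∧ ν ∈ offDiag p ∧ k ∈ offDiag (1 - p) ∧
      ∃ ℓ' : Module.Dual ℂ W, ℓ' ≠ 0 ∧
        (∀ (z : offDiag p) w, ℓ' (ϖ (oneAdd z) w) = ψ (LinearMap.trace F V (k * z)) * ℓ' w) ∧
        ∀ m : V ≃ₗ[F] V, p * m = m * p → k * m = m * k → ∀ w, ℓ' (ϖ m w) = ℓ' w := by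
  have h1 : p * (1 - p) = 0 := by rw [mul_sub, mul_one, hp, sub_self]
  have h2 : (1 - p) * p = 0 := by rw [sub_mul, one_mul, hp, sub_self]
  have h3 : (1 - p) * (1 - p) = 1 - p := by rw [mul_sub, h2, mul_one, sub_zero]
  obtain ⟨k, hk, ℓ', hℓ0', hz, hm⟩ := exists_fourier_coeff hψ hp hℓ0 hℓ
  obtain ⟨l, hl, ℓ₂, hℓ₂, hz₂, hm₂⟩ := exists_fourier_coeff (p := 1 - p) hψ h3 hℓ0
    fun g hg => hℓ g (by rwa [sub_mul, mul_sub, one_mul, mul_one, sub_right_inj] at hg)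
  obtain ⟨a, ha⟩ := exists_mul_eq_of_comp_eq_zero fun φ hφ =>
    apply_eq_zero_of_comp_eq_zero hp hk hℓ0' hz hm hno hφ
  obtain ⟨b, hb⟩ := exists_mul_eq_of_comp_eq_zero fun φ hφ =>
    apply_eq_zero_of_comp_eq_zero h3 hl hℓ₂ hz₂ hm₂ hno hφ
  have hlp : l * p = l := by simpa using hl.2
  have hν : k * ((1 - p) * a * p) = p := by rw [← mul_assoc, ← mul_assoc, hk.2, ha, hp]
  have hνp : (1 - p) * ((1 - p) * a * p) = (1 - p) * a * p := by
    rw [← mul_assoc, ← mul_assoc, h3]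
  set ν := (1 - p) * a * p with hνdef
  have hle : LinearMap.range ν ≤ LinearMap.range (1 - p) := by
    rintro _ ⟨v, rfl⟩
    exact ⟨ν v, LinearMap.congr_fun hνp v⟩
  have hrank : Module.finrank F (LinearMap.range (1 - p)) ≤
      Module.finrank F (LinearMap.range ν) := by
    have e1 : LinearMap.range (1 - p) ≤ (LinearMap.range p).map l := by
      rintro _ ⟨v, rfl⟩
      refine ⟨p (b v), ⟨_, rfl⟩, ?_⟩
      rw [← hb, ← Module.End.mul_apply, hlp]
      rfl
    have e2 : LinearMap.range p ≤ (LinearMap.range ν).map k := by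
      rintro _ ⟨v, rfl⟩
      exact ⟨ν v, ⟨_, rfl⟩, LinearMap.congr_fun hν v⟩
    exact (Submodule.finrank_mono e1).trans ((Submodule.finrank_map_le _ _).trans
      ((Submodule.finrank_mono e2).trans (Submodule.finrank_map_le _ _)))
  have heq := Submodule.eq_of_le_of_finrank_le hle hrank
  refine ⟨ν, k, hν, ?_, ⟨?_, ?_⟩, hk, ℓ', hℓ0', hz, hm⟩
  · refine LinearMap.ext fun v => ?_
    obtain ⟨x, hx⟩ : (1 - p) v ∈ LinearMap.range ν := heq ▸ ⟨v, rfl⟩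
    have h5 : ν * k * ν = ν := by rw [mul_assoc, hν, hνdef, mul_assoc, hp]
    rw [← hk.2, ← mul_assoc, Module.End.mul_apply, ← hx, ← Module.End.mul_apply, h5]
  · rw [hνdef, ← mul_assoc, ← mul_assoc, h1, zero_mul, zero_mul]
  · rw [hνdef, mul_assoc, hp]

end Nondegenerate

section Centralizer

variable {F V : Type} [Field F] [AddCommGroup V] [Module F V]

/-- `ν` and `k` are mutually inverse isomorphisms between the image and the kernel of `p`. -/
structure IsSwap (p ν k : Module.End F V) : Prop where
  idem : p * p = p
  left : k * ν = p
  right : ν * k = 1 - p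
  mem : ν ∈ offDiag p
  mem' : k ∈ offDiag (1 - p)

/-- The automorphisms commuting with `ν`. -/
def cent (ν : Module.End F V) : Subgroup (V ≃ₗ[F] V) where
  carrier := {g | ν * (g : Module.End F V) = g * ν}
  one_mem' := (mul_one ν).trans (one_mul ν).symm
  mul_mem' := fun {a b} ha hb => by
    change ν * (a * b : Module.End F V) = a * b * ν
    rw [← mul_assoc, ha, mul_assoc, hb, mul_assoc]
  inv_mem' := fun {a} ha => by
    change ν * ((a⁻¹ : V ≃ₗ[F] V) : Module.End F V) = (a⁻¹ : V ≃ₗ[F] V) * ν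
    calc ν * ((a⁻¹ : V ≃ₗ[F] V) : Module.End F V)
        = (a⁻¹ : V ≃ₗ[F] V) * (a : Module.End F V) * ν * (a⁻¹ : V ≃ₗ[F] V) := by
          rw [coe_inv_mul_coe, one_mul]
      _ = (a⁻¹ : V ≃ₗ[F] V) * ν * ((a : Module.End F V) * (a⁻¹ : V ≃ₗ[F] V)) := by
          rw [mul_assoc _ (a : Module.End F V), ← ha]; noncomm_ring
      _ = _ := by rw [coe_mul_coe_inv, mul_one]

theorem mem_cent {ν : Module.End F V} {g : V ≃ₗ[F] V} :
    g ∈ cent ν ↔ ν * (g : Module.End F V) = g * ν := Iff.rfl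

/-- The exponential of `theta`, a character of the centralizer of `ν`. -/
def thetaChar [FiniteDimensional F V] (ψ : AddChar F ℂ) {ν k : Module.End F V} (hν : ν * ν = 0)
    (hk : ν * k + k * ν = 1) : cent ν →* ℂ where
  toFun g := ψ (theta ν k (g : V ≃ₗ[F] V) ((g : V ≃ₗ[F] V)⁻¹ : V ≃ₗ[F] V))
  map_one' := by
    have : theta ν k ((1 : V ≃ₗ[F] V) : Module.End F V) (((1 : V ≃ₗ[F] V)⁻¹ : V ≃ₗ[F] V)) = 0 := by
      have h1 : ((1 : V ≃ₗ[F] V) : Module.End F V) = 1 := rfl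
      rw [inv_one, h1, theta, mul_one, one_mul, sub_self, mul_zero, map_zero]
    rw [OneMemClass.coe_one, this, AddChar.map_zero_eq_one]
  map_mul' g h := by
    rw [← AddChar.map_add_eq_mul, ← theta_mul hν hk (coe_mul_coe_inv _) g.2 (coe_mul_coe_inv _) h.2,
      Subgroup.coe_mul, _root_.mul_inv_rev, coe_mul, coe_mul]

namespace IsSwap

variable {p ν k : Module.End F V} (h : IsSwap p ν k)
include h

theorem sq : ν * ν = 0 := mul_eq_zero_of_offDiag h.mem h.mem

theorem homotopy : ν * k + k * ν = 1 := by rw [h.left, h.right, sub_add_cancel]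

theorem mul_zero_right : k * p = 0 := by
  have := h.mem'.2
  rwa [mul_sub, mul_one, sub_eq_self] at this

theorem mul_left : p * k = k := by
  have := h.mem'.1
  rwa [sub_mul, one_mul, sub_eq_zero, eq_comm] at this

theorem p_mul_q : p * (1 - p) = 0 := by rw [mul_sub, mul_one, h.idem, sub_self]

theorem q_mul_p : (1 - p) * p = 0 := by rw [sub_mul, one_mul, h.idem, sub_self]

theorem q_mul_q : (1 - p) * (1 - p) = 1 - p := by rw [mul_sub, h.q_mul_p, mul_one, sub_zero]

/-- The commutant of `ν` is block triangular. -/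
theorem block_eq_zero {s : Module.End F V} (hs : ν * s = s * ν) : p * s * (1 - p) = 0 := by
  calc p * s * (1 - p) = k * (ν * s) * ν * k := by rw [← h.right, ← h.left]; noncomm_ring
    _ = k * s * (ν * ν) * k := by rw [hs]; noncomm_ring
    _ = 0 := by rw [h.sq]; noncomm_ring

theorem diag_commute {s : Module.End F V} (hs : ν * s = s * ν) :
    k * (p * s * p + (1 - p) * s * (1 - p)) = (p * s * p + (1 - p) * s * (1 - p)) * k := by
  calc k * (p * s * p + (1 - p) * s * (1 - p))
      = (k * p) * s * p + (k * (1 - p)) * s * (1 - p) := by noncomm_ring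
    _ = k * s * (1 - p) := by rw [h.mul_zero_right, h.mem'.2]; noncomm_ring
    _ = k * (s * ν) * k := by rw [← h.right]; noncomm_ring
    _ = p * s * k := by rw [← hs, ← mul_assoc, h.left]
    _ = p * s * (p * k) + (1 - p) * s * ((1 - p) * k) := by
      rw [h.mul_left, h.mem'.1, mul_zero, add_zero]
    _ = _ := by noncomm_ring

theorem diag_mul_diag {s s' : Module.End F V} (hs : ν * s = s * ν) (hs' : ν * s' = s' * ν)
    (hss' : s * s' = 1) :
    (p * s * p + (1 - p) * s * (1 - p)) * (p * s' * p + (1 - p) * s' * (1 - p)) = 1 := by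
  calc (p * s * p + (1 - p) * s * (1 - p)) * (p * s' * p + (1 - p) * s' * (1 - p))
      = p * s * (p * p) * s' * p + (1 - p) * s * ((1 - p) * (1 - p)) * s' * (1 - p)
        + p * s * (p * (1 - p)) * s' * (1 - p) + (1 - p) * s * ((1 - p) * p) * s' * p := by
        noncomm_ring
    _ = p * s * p * s' * p + (1 - p) * s * (1 - p) * s' * (1 - p) := by
      rw [h.idem, h.p_mul_q, h.q_mul_p, h.q_mul_q]; noncomm_ring
    _ = p * (s * s') * p - (p * s * (1 - p)) * s' * p + (1 - p) * (s * s') * (1 - p)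
        - (1 - p) * s * (p * s' * (1 - p)) := by noncomm_ring
    _ = 1 := by
      rw [h.block_eq_zero hs, h.block_eq_zero hs', hss', mul_one, mul_one, h.idem, h.q_mul_q]
      noncomm_ring

theorem exists_factor {s : V ≃ₗ[F] V} (hs : s ∈ cent ν) :
    ∃ (m : V ≃ₗ[F] V) (z : offDiag p), s = m * oneAdd z ∧ p * (m : Module.End F V) = m * p ∧
      k * (m : Module.End F V) = m * k := by
  have hs' : ν * ((s⁻¹ : V ≃ₗ[F] V) : Module.End F V) = (s⁻¹ : V ≃ₗ[F] V) * ν :=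
    (cent ν).inv_mem hs
  let m : V ≃ₗ[F] V := LinearEquiv.ofLinearMap
    (p * (s : Module.End F V) * p + (1 - p) * (s : Module.End F V) * (1 - p))
    (p * ((s⁻¹ : V ≃ₗ[F] V) : Module.End F V) * p +
      (1 - p) * ((s⁻¹ : V ≃ₗ[F] V) : Module.End F V) * (1 - p))
    (h.diag_mul_diag hs hs' (coe_mul_coe_inv s)) (h.diag_mul_diag hs' hs (coe_inv_mul_coe s))
  have hm : (m : Module.End F V) =
    p * (s : Module.End F V) * p + (1 - p) * (s : Module.End F V) * (1 - p) := rfl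
  have hm' : ((m⁻¹ : V ≃ₗ[F] V) : Module.End F V) = p * ((s⁻¹ : V ≃ₗ[F] V) : Module.End F V) * p +
      (1 - p) * ((s⁻¹ : V ≃ₗ[F] V) : Module.End F V) * (1 - p) := rfl
  have hmp : p * ((m⁻¹ : V ≃ₗ[F] V) : Module.End F V) * (1 - p) = 0 := by
    rw [hm']
    calc _ = p * p * ((s⁻¹ : V ≃ₗ[F] V) : Module.End F V) * (p * (1 - p)) +
      (p * (1 - p)) * ((s⁻¹ : V ≃ₗ[F] V) : Module.End F V) * (1 - p) * (1 - p) := by noncomm_ring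
      _ = 0 := by rw [h.p_mul_q]; noncomm_ring
  let z : offDiag p := ⟨(m⁻¹ : V ≃ₗ[F] V) * ((1 - p) * (s : Module.End F V) * p), by
    refine ⟨?_, ?_⟩
    · rw [← mul_assoc, ← mul_assoc, ← mul_assoc, hmp, zero_mul, zero_mul]
    · rw [mul_assoc, mul_assoc _ p, h.idem]⟩
  refine ⟨m, z, coe_injective ?_, ?_, ?_⟩
  · rw [coe_mul, coe_oneAdd]
    change (s : Module.End F V) = m * (1 + (m⁻¹ : V ≃ₗ[F] V) * ((1 - p) * (s : Module.End F V) * p))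
    rw [mul_add, ← mul_assoc, coe_mul_coe_inv, hm]
    calc (s : Module.End F V) = p * s * p + (1 - p) * s * (1 - p) + (1 - p) * s * p
          + p * s * (1 - p) := by noncomm_ring
      _ = _ := by rw [h.block_eq_zero hs]; noncomm_ring
  · rw [hm, mul_add, add_mul]
    calc _ = (p * p) * s * p + (p * (1 - p)) * s * (1 - p) := by noncomm_ring
      _ = p * s * (p * p) + (1 - p) * s * ((1 - p) * p) := by
        rw [h.idem, h.p_mul_q, h.q_mul_p]; noncomm_ring
      _ = _ := by noncomm_ring
  · rw [hm]
    exact h.diag_commute hs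

theorem oneAdd_mem (z : offDiag p) : oneAdd z ∈ cent ν := by
  change ν * (1 + z : Module.End F V) = (1 + z) * ν
  rw [mul_add, add_mul, mul_eq_zero_of_offDiag h.mem z.2, mul_eq_zero_of_offDiag z.2 h.mem,
    mul_one, one_mul]

variable {W : Type} [AddCommGroup W] [Module ℂ W] {ϖ : Representation ℂ (V ≃ₗ[F] V) W}

theorem functional_eigen [FiniteDimensional F V] {ψ : AddChar F ℂ} {ℓ : Module.Dual ℂ W}
    (hz : ∀ (z : offDiag p) w, ℓ (ϖ (oneAdd z) w) = ψ (LinearMap.trace F V (k * z)) * ℓ w)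
    (hm : ∀ m : V ≃ₗ[F] V, p * m = m * p → k * m = m * k → ∀ w, ℓ (ϖ m w) = ℓ w)
    (s : cent ν) (w : W) : ℓ (ϖ s w) = thetaChar ψ h.sq h.homotopy s * ℓ w := by
  obtain ⟨m, z, hs, hmp, hmk⟩ := h.exists_factor s.2
  have hmν : ν * (m : Module.End F V) = m * ν := by
    have hq : (m : Module.End F V) * (ν * k) = (ν * k) * m := by
      rw [h.right, mul_sub, sub_mul, ← hmp]; simp
    calc ν * (m : Module.End F V) = ν * p * m := by rw [h.mem.2]
      _ = ν * (m * k) * ν := by rw [mul_assoc, hmp, ← h.left]; noncomm_ring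
      _ = (m * (ν * k)) * ν := by rw [← hmk, hq]; noncomm_ring
      _ = m * ν * (k * ν) := by noncomm_ring
      _ = _ := by rw [h.left, mul_assoc, h.mem.2]
  have h1 : s = (⟨m, hmν⟩ : cent ν) * ⟨oneAdd z, h.oneAdd_mem z⟩ := Subtype.ext hs
  have h2 : thetaChar ψ h.sq h.homotopy ⟨m, hmν⟩ = 1 := by
    change ψ (theta ν k m (m⁻¹ : V ≃ₗ[F] V)) = 1
    rw [theta, ← hmk, mul_assoc k, coe_mul_coe_inv, mul_one, sub_self, mul_zero, map_zero,
      AddChar.map_zero_eq_one]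
  have h3 : thetaChar ψ h.sq h.homotopy ⟨oneAdd z, h.oneAdd_mem z⟩ =
      ψ (LinearMap.trace F V (k * z)) := by
    rw [LinearMap.trace_mul_comm, ← theta_one_add h.homotopy (mul_eq_zero_of_offDiag h.mem z.2)
      (mul_eq_zero_of_offDiag z.2 h.mem) (coe_mul_coe_inv (oneAdd z))]
    rfl
  rw [hs, rep_mul, hm m hmp hmk, hz, h1, map_mul (thetaChar ψ h.sq h.homotopy), h2, h3, one_mul]

end IsSwap

end Centralizer

section Reflection

variable {F V : Type} [Field F] [AddCommGroup V] [Module F V]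

theorem theta_inv [FiniteDimensional F V] {ν k w w' : Module.End F V} (hν : ν * ν = 0)
    (hk : ν * k + k * ν = 1) (hw : w * w' = 1) (hw1 : ν * w = w * ν) :
    theta ν k w' w = -theta ν k w w' := by
  have h1 := theta_mul hν hk hw hw1 (mul_eq_one_comm.1 hw) (commute_inv hw hw1)
  have h2 : theta ν k (1 : Module.End F V) 1 = 0 := by
    rw [theta, mul_one, one_mul, sub_self, mul_zero, map_zero]
  rw [hw, h2] at h1
  exact eq_neg_of_add_eq_zero_right h1.symm

theorem addChar_eq_one_of_sq [Finite F] (h2 : (2 : F) ≠ 0) (ψ : AddChar F ℂ) {c : F}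
    (h : ψ c * ψ c = 1) : ψ c = 1 := by
  have := Fintype.ofFinite F
  have h3 : ringChar F ≠ 2 := fun h => h2 (by
    have := ringChar.charP F
    rw [h] at this
    exact_mod_cast CharP.cast_eq_zero F 2)
  obtain ⟨j, hj⟩ := Nat.odd_iff.2 (FiniteField.odd_card_of_char_ne_two h3)
  have h4 : ψ c ^ Fintype.card F = 1 := by
    rw [← AddChar.map_nsmul_eq_pow, card_nsmul_eq_zero, AddChar.map_zero_eq_one]
  rwa [hj, pow_succ, pow_mul, pow_two, h, one_pow, one_mul] at h4

namespace IsSwap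

variable {p ν k : Module.End F V} (h : IsSwap p ν k)
include h

theorem reflection_sq : (p + p - 1) * (p + p - 1) = 1 := by
  calc (p + p - 1) * (p + p - 1) = 4 • (p * p) - 4 • p + 1 := by noncomm_ring
    _ = 1 := by rw [h.idem, sub_self, zero_add]

/-- The reflection attached to a projection. -/
def reflection : V ≃ₗ[F] V :=
  LinearEquiv.ofLinearMap (p + p - 1) (p + p - 1) h.reflection_sq h.reflection_sq

theorem coe_reflection : (h.reflection : Module.End F V) = p + p - 1 := rfl

theorem reflection_mul_self : h.reflection * h.reflection = 1 := coe_injective h.reflection_sq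

theorem reflection_inv : h.reflection⁻¹ = h.reflection :=
  inv_eq_of_mul_eq_one_right h.reflection_mul_self

theorem reflection_mul : (h.reflection : Module.End F V) * ν = -ν := by
  rw [coe_reflection, sub_mul, add_mul, h.mem.1]; simp

theorem mul_reflection : ν * (h.reflection : Module.End F V) = ν := by
  rw [coe_reflection, mul_sub, mul_add, h.mem.2]; simp

theorem reflection_mul' : (h.reflection : Module.End F V) * k = k := by
  rw [coe_reflection, sub_mul, add_mul, h.mul_left]; simp

theorem mul_reflection' : k * (h.reflection : Module.End F V) = -k := by
  rw [coe_reflection, mul_sub, mul_add, h.mul_zero_right]; simp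

/-- The anti-involution `g ↦ a g⁻¹ a` of the general linear group. -/
def flip (g : V ≃ₗ[F] V) : V ≃ₗ[F] V := h.reflection * g⁻¹ * h.reflection

theorem flip_mul (g g' : V ≃ₗ[F] V) : h.flip (g * g') = h.flip g' * h.flip g := by
  have : h.flip g' * h.flip g =
      h.reflection * g'⁻¹ * (h.reflection * h.reflection) * g⁻¹ * h.reflection := by
    simp only [flip, mul_assoc]
  rw [this, h.reflection_mul_self, mul_one, flip, _root_.mul_inv_rev]
  simp only [mul_assoc]

theorem flip_inv (g : V ≃ₗ[F] V) : (h.flip g)⁻¹ = h.reflection * g * h.reflection := by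
  rw [flip, _root_.mul_inv_rev, _root_.mul_inv_rev, inv_inv, h.reflection_inv, mul_assoc]

theorem flip_flip (g : V ≃ₗ[F] V) : h.flip (h.flip g) = g := by
  have : h.flip (h.flip g) =
      (h.reflection * h.reflection) * g * (h.reflection * h.reflection) := by
    rw [flip, h.flip_inv]; simp only [mul_assoc]
  rw [this, h.reflection_mul_self, one_mul, mul_one]

theorem flip_mem {s : V ≃ₗ[F] V} (hs : s ∈ cent ν) : h.flip s ∈ cent ν := by
  have hs' : ν * ((s⁻¹ : V ≃ₗ[F] V) : Module.End F V) = (s⁻¹ : V ≃ₗ[F] V) * ν :=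
    (cent ν).inv_mem hs
  rw [mem_cent, flip, coe_mul, coe_mul, mul_assoc _ _ ν, h.reflection_mul, ← mul_assoc,
    ← mul_assoc, h.mul_reflection, hs', mul_assoc, h.mul_reflection, mul_neg, mul_assoc, ← hs',
    ← mul_assoc, h.reflection_mul, neg_mul, neg_neg]

theorem theta_flip [FiniteDimensional F V] {s : V ≃ₗ[F] V} (hs : s ∈ cent ν) :
    theta ν k (h.flip s) ((h.flip s)⁻¹ : V ≃ₗ[F] V) = theta ν k s (s⁻¹ : V ≃ₗ[F] V) := by
  rw [h.flip_inv, ← neg_inj, ← theta_inv h.sq h.homotopy (coe_mul_coe_inv s) hs, theta, theta, flip,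
    coe_mul, coe_mul, coe_mul, coe_mul]
  set a := (h.reflection : Module.End F V) with ha
  have h1 : a * k * a = -k := by rw [h.reflection_mul', h.mul_reflection']
  have h2 : a * (ν * k) * a = ν * k := by
    rw [← mul_assoc, h.reflection_mul, mul_assoc, h.mul_reflection', neg_mul_neg]
  generalize ((s⁻¹ : V ≃ₗ[F] V) : Module.End F V) = w
  generalize (s : Module.End F V) = w'
  have h3 : a * w * a * k * (a * w' * a) - k = -(a * (w * k * w' - k) * a) := by
    calc a * w * a * k * (a * w' * a) - k = a * w * (a * k * a) * w' * a - k := by noncomm_ring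
      _ = a * w * -k * w' * a - k := by rw [h1]
      _ = -(a * (w * k * w' - k) * a) - (a * k * a + k) := by noncomm_ring
      _ = _ := by rw [h1]; simp
  rw [h3, mul_neg, map_neg, neg_neg, ← mul_assoc, LinearMap.trace_mul_comm, ← mul_assoc,
      ← mul_assoc,
    h2]

theorem thetaChar_flip [FiniteDimensional F V] (ψ : AddChar F ℂ) (s : cent ν) :
    thetaChar ψ h.sq h.homotopy ⟨h.flip s, h.flip_mem s.2⟩ = thetaChar ψ h.sq h.homotopy s :=
  congrArg ψ (h.theta_flip s.2)

end IsSwap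
end Reflection

section SwapTrace

theorem trace_mul_eigenProj {G W : Type} [Group G] [Finite G] [AddCommGroup W] [Module ℂ W]
    {ϖ : Representation ℂ G W} {K : Subgroup G} {χ : K →* ℂ} (k l : K) (g : G) :
    LinearMap.trace ℂ W (ϖ (k * g * l) * eigenProj ϖ K χ) =
      χ k * χ l * LinearMap.trace ℂ W (ϖ g * eigenProj ϖ K χ) := by
  rw [map_mul ϖ, map_mul ϖ, mul_assoc, mul_eigenProj, mul_smul_comm, map_smul, mul_assoc,
    LinearMap.trace_mul_comm, mul_assoc, eigenProj_mul, mul_smul_comm, map_smul, smul_eq_mul,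
    smul_eq_mul, mul_left_comm, mul_assoc]

variable {F V W : Type} [Field F] [AddCommGroup V] [Module F V] {p ν k : Module.End F V}

theorem conj_mem_cent {g s : V ≃ₗ[F] V}
    (h : (g : Module.End F V) * ν * (g⁻¹ : V ≃ₗ[F] V) * (s : Module.End F V) =
      s * ((g : Module.End F V) * ν * (g⁻¹ : V ≃ₗ[F] V))) : g⁻¹ * s * g ∈ cent ν := by
  rw [mem_cent, coe_mul, coe_mul]
  have h1 := coe_inv_mul_coe g
  set a := (g : Module.End F V)
  set b := ((g⁻¹ : V ≃ₗ[F] V) : Module.End F V)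
  calc ν * (b * s * a) = b * a * ν * (b * s * a) := by rw [h1, one_mul]
    _ = b * (a * ν * b * s) * a := by noncomm_ring
    _ = b * s * a * ν * (b * a) := by rw [h]; noncomm_ring
    _ = _ := by rw [h1, mul_one]

theorem theta_conj (g : V ≃ₗ[F] V) (w w' : Module.End F V) :
    theta ν k (((g⁻¹ : V ≃ₗ[F] V) : Module.End F V) * w * (g : Module.End F V))
      (((g⁻¹ : V ≃ₗ[F] V) : Module.End F V) * w' * (g : Module.End F V)) =
      theta ((g : Module.End F V) * ν * ((g⁻¹ : V ≃ₗ[F] V) : Module.End F V))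
        ((g : Module.End F V) * k * ((g⁻¹ : V ≃ₗ[F] V) : Module.End F V)) w w' := by
  have h1 := coe_inv_mul_coe g
  have h2 := coe_mul_coe_inv g
  rw [theta, theta]
  set a := (g : Module.End F V)
  set b := ((g⁻¹ : V ≃ₗ[F] V) : Module.End F V)
  have h3 : a * ν * b * (a * k * b) * (w * (a * k * b) * w' - a * k * b) =
      a * (ν * k * (b * w * a * k * (b * w' * a) - k)) * b := by
    calc _ = a * ν * (b * a) * k * (b * w * a * k * b * w' * 1 - (b * a) * k * b) := by
          noncomm_ring
      _ = a * ν * k * (b * w * a * k * b * w' * (a * b) - k * b) := by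
          rw [h1, h2]; noncomm_ring
      _ = _ := by noncomm_ring
  rw [h3, LinearMap.trace_mul_comm F (a * _) b, ← mul_assoc b a, h1, one_mul]

namespace IsSwap

variable [FiniteDimensional F V] [Finite F] [Finite V] [AddCommGroup W] [Module ℂ W]
  {ϖ : Representation ℂ (V ≃ₗ[F] V) W} {ψ : AddChar F ℂ} (h : IsSwap p ν k)
include h

theorem exists_flip_eq (hψ : ∃ a, ψ a ≠ 1) {g : V ≃ₗ[F] V}
    (hg : LinearMap.trace ℂ W
      (ϖ g * eigenProj ϖ (cent ν) (thetaChar ψ h.sq h.homotopy)) ≠ 0) :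
    ∃ s₁ s₂ : cent ν, h.flip g = s₁ * g * s₂ := by
  have ha := coe_inv_mul_coe g
  have ha' := coe_mul_coe_inv g
  set a := (g : Module.End F V) with ha0
  set b := ((g⁻¹ : V ≃ₗ[F] V) : Module.End F V) with hb0
  have hν' : (a * ν * b) * (a * ν * b) = 0 := by
    calc _ = a * ν * (b * a) * ν * b := by noncomm_ring
      _ = a * (ν * ν) * b := by rw [ha]; noncomm_ring
      _ = 0 := by rw [h.sq]; noncomm_ring
  have hk' : (a * ν * b) * (a * k * b) + (a * k * b) * (a * ν * b) = 1 := by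
    calc _ = a * ν * (b * a) * k * b + a * k * (b * a) * ν * b := by noncomm_ring
      _ = a * (ν * k + k * ν) * b := by rw [ha]; noncomm_ring
      _ = 1 := by rw [h.homotopy, mul_one, ha']
  obtain ⟨T, hT1, hT2⟩ := exists_swap hψ (Module.finrank F V) le_rfl h.sq hν' h.homotopy hk' (by
    intro w w' hw hw1 hw2
    let s : V ≃ₗ[F] V := LinearEquiv.ofLinearMap w w' hw (mul_eq_one_comm.1 hw)
    have hs : s ∈ cent ν := hw1
    have hx : g⁻¹ * s * g ∈ cent ν := conj_mem_cent hw2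
    have h1 := trace_mul_eigenProj (ϖ := ϖ) (χ := thetaChar ψ h.sq h.homotopy) ⟨s, hs⟩ 1 g
    have h2 := trace_mul_eigenProj (ϖ := ϖ) (χ := thetaChar ψ h.sq h.homotopy) 1 ⟨_, hx⟩ g
    have h3 : ((⟨s, hs⟩ : cent ν) : V ≃ₗ[F] V) * g * (1 : cent ν) =
        (1 : cent ν) * g * (⟨_, hx⟩ : cent ν) := by
      simp [mul_assoc]
    rw [h3, h2, map_one, mul_one, one_mul] at h1
    have h4 : ψ (theta ν k (g⁻¹ * s * g : V ≃ₗ[F] V) ((g⁻¹ * s * g)⁻¹ : V ≃ₗ[F] V)) =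
      ψ (theta ν k w w') := mul_right_cancel₀ hg h1
    have h5 : (((g⁻¹ * s * g)⁻¹ : V ≃ₗ[F] V) : Module.End F V) = b * w' * a := by
      rw [_root_.mul_inv_rev, _root_.mul_inv_rev, inv_inv, ← mul_assoc]
      rfl
    have h6 : ((g⁻¹ * s * g : V ≃ₗ[F] V) : Module.End F V) = b * w * a := rfl
    rw [h5, h6, theta_conj] at h4
    rw [AddChar.map_sub_eq_div, ← h4]
    exact div_self (ψ.val_isUnit _).ne_zero)
  have hT1' : (T : Module.End F V) * ν = -(a * ν * b * T) := LinearMap.ext hT1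
  have hT2' : (T : Module.End F V) * (a * ν * b) = -(ν * T) := LinearMap.ext hT2
  have hTT := coe_mul_coe_inv T
  have hTT' := coe_inv_mul_coe T
  have hr := h.reflection_mul
  have hr' := h.mul_reflection
  refine ⟨⟨h.reflection * g⁻¹ * T⁻¹, ?_⟩, ⟨g⁻¹ * T * h.reflection, ?_⟩, ?_⟩
  · rw [mem_cent, coe_mul, coe_mul, ← hb0]
    set t := (T : Module.End F V)
    set t' := ((T⁻¹ : V ≃ₗ[F] V) : Module.End F V)
    set r := (h.reflection : Module.End F V)
    have h7 : t' * ν = -(a * ν * b * t') := by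
      calc t' * ν = t' * (ν * t) * t' := by rw [mul_assoc, mul_assoc, hTT, mul_one]
        _ = -(t' * (t * (a * ν * b)) * t') := by rw [hT2']; noncomm_ring
        _ = -((t' * t) * (a * ν * b) * t') := by noncomm_ring
        _ = _ := by rw [hTT', one_mul]
    calc ν * (r * b * t') = (ν * r) * b * t' := by noncomm_ring
      _ = -((r * ν) * b * t') := by rw [hr, hr']; noncomm_ring
      _ = -(r * 1 * ν * b * t') := by noncomm_ring
      _ = r * b * -(a * ν * b * t') := by rw [← ha]; noncomm_ring
      _ = _ := by rw [← h7]; noncomm_ring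
  · rw [mem_cent, coe_mul, coe_mul, ← hb0]
    set t := (T : Module.End F V)
    set r := (h.reflection : Module.End F V)
    calc ν * (b * t * r) = 1 * ν * b * t * r := by noncomm_ring
      _ = -(b * (-(a * ν * b * t)) * r) := by rw [← ha]; noncomm_ring
      _ = -(b * t * (ν * r)) := by rw [← hT1']; noncomm_ring
      _ = b * t * (r * ν) := by rw [hr, hr']; noncomm_ring
      _ = _ := by noncomm_ring
  · change h.reflection * g⁻¹ * h.reflection =
      h.reflection * g⁻¹ * T⁻¹ * g * (g⁻¹ * T * h.reflection)
    group

theorem trace_flip_of_ne_zero (h2 : (2 : F) ≠ 0) (hψ : ∃ a, ψ a ≠ 1) {g : V ≃ₗ[F] V}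
    (hg : LinearMap.trace ℂ W
      (ϖ g * eigenProj ϖ (cent ν) (thetaChar ψ h.sq h.homotopy)) ≠ 0) :
    LinearMap.trace ℂ W (ϖ (h.flip g) * eigenProj ϖ (cent ν) (thetaChar ψ h.sq h.homotopy)) =
      LinearMap.trace ℂ W (ϖ g * eigenProj ϖ (cent ν) (thetaChar ψ h.sq h.homotopy)) := by
  obtain ⟨s₁, s₂, hs⟩ := h.exists_flip_eq hψ hg
  set χ := thetaChar ψ h.sq h.homotopy with hχ
  have h3 : g = (⟨h.flip s₂, h.flip_mem s₂.2⟩ : cent ν) * h.flip g *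
      (⟨h.flip s₁, h.flip_mem s₁.2⟩ : cent ν) := by
    calc g = h.flip (s₁ * g * s₂) := by rw [← hs, h.flip_flip]
      _ = _ := by rw [h.flip_mul, h.flip_mul, ← mul_assoc]
  have h4 := trace_mul_eigenProj (ϖ := ϖ) (χ := χ) s₁ s₂ g
  have h5 := trace_mul_eigenProj (ϖ := ϖ) (χ := χ) ⟨h.flip s₂, h.flip_mem s₂.2⟩
    ⟨h.flip s₁, h.flip_mem s₁.2⟩ (h.flip g)
  rw [← h3, hχ, h.thetaChar_flip, h.thetaChar_flip, ← hχ, hs, h4, mul_comm (χ s₂), ← mul_assoc,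
    eq_comm, mul_left_eq_self₀] at h5
  obtain ⟨c, hc⟩ : ∃ c, χ s₁ * χ s₂ = ψ c := ⟨_, (AddChar.map_add_eq_mul ψ _ _).symm⟩
  have h6 := h5.resolve_right hg
  rw [hc] at h6
  rw [hs, h4, hc, addChar_eq_one_of_sq h2 ψ h6, one_mul]

theorem trace_flip (h2 : (2 : F) ≠ 0) (hψ : ∃ a, ψ a ≠ 1) (g : V ≃ₗ[F] V) :
    LinearMap.trace ℂ W (ϖ (h.flip g) * eigenProj ϖ (cent ν) (thetaChar ψ h.sq h.homotopy)) =
      LinearMap.trace ℂ W (ϖ g * eigenProj ϖ (cent ν) (thetaChar ψ h.sq h.homotopy)) := by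
  by_cases hg : LinearMap.trace ℂ W
      (ϖ g * eigenProj ϖ (cent ν) (thetaChar ψ h.sq h.homotopy)) = 0
  · by_contra hne
    rw [hg] at hne
    have := h.trace_flip_of_ne_zero h2 hψ hne
    rw [h.flip_flip, hg] at this
    exact hne this.symm
  · exact h.trace_flip_of_ne_zero h2 hψ hg

theorem classSym [FiniteDimensional ℂ W] (h2 : (2 : F) ≠ 0) (hψ : ∃ a, ψ a ≠ 1)
    (hirr : ∀ K : Submodule ℂ W, (∀ g, ∀ w ∈ K, ϖ g w ∈ K) → K = ⊥ ∨ K = ⊤)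
    {ℓ : Module.Dual ℂ W} (hℓ0 : ℓ ≠ 0)
    (hℓ : ∀ (s : cent ν) w, ℓ (ϖ s w) = thetaChar ψ h.sq h.homotopy s * ℓ w) : ClassSym ϖ := by
  have he : eigenProj ϖ (cent ν) (thetaChar ψ h.sq h.homotopy) ≠ 0 := fun h0 =>
    hℓ0 (LinearMap.ext fun w => by rw [← functional_eigenProj hℓ, h0]; simp)
  refine ClassSym.of_irred hirr (trace_eigenProj_ne_zero he) fun s => ?_
  symm
  refine Fintype.sum_equiv (Equiv.mulLeft h.reflection) _ _ fun g => ?_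
  rw [← h.trace_flip h2 hψ, Equiv.coe_mulLeft]
  congr 3

end IsSwap
end SwapTrace

section Induction

theorem Flagged.one_mem {F V : Type} [Field F] [AddCommGroup V] [Module F V]
    {J : Set (V ≃ₗ[F] V)} (h : Flagged F V J) : 1 ∈ J := by
  induction h with
  | base V A hA J h => exact h 1 fun _ => rfl
  | step V W hW JW hJW J h ih => exact h 1 1 ih fun _ => rfl

variable {F V W : Type} [Field F] [AddCommGroup V] [Module F V] [Finite V] [AddCommGroup W]
  [Module ℂ W] {ϖ : Representation ℂ (V ≃ₗ[F] V) W}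

theorem classSym_of_fixInv_ne_bot [FiniteDimensional F V] [FiniteDimensional ℂ W]
    (h : TraceSymAll F V) (hϖ : Good ϖ)
    (hirr : ∀ K : Submodule ℂ W, (∀ g, ∀ w ∈ K, ϖ g w ∈ K) → K = ⊥ ∨ K = ⊤)
    {U : Submodule F V} (hU : IsHyp U) (hne : fixInv ϖ U ≠ ⊥) : ClassSym ϖ := by
  have he : eigenProj ϖ (fixer U) 1 ≠ 0 := fun h0 => by
    refine hne ((Submodule.eq_bot_iff _).2 fun w hw => ?_)
    have h1 : eigenProj ϖ (fixer U) 1 w = w :=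
      eigenProj_apply_of_eigen fun q => (hw q q.2).trans (one_smul ℂ w).symm
    rw [← h1, h0, LinearMap.zero_apply]
  refine ClassSym.of_irred hirr (trace_eigenProj_ne_zero he) fun s =>
    Finset.sum_congr rfl fun g _ => ?_
  rw [h W ϖ hϖ U hU _ (fun g hg => eigenProj_fixer_comm hg) (fun q hq => mul_eigenProj_fixer hq),
    _root_.mul_inv_rev, _root_.mul_inv_rev, inv_inv, mul_assoc]

theorem functional_eq_zero_of_fixInv_eq_bot {U : Submodule F V} (hU : fixInv ϖ U = ⊥)
    {ℓ : Module.Dual ℂ W} (hℓ : ∀ q ∈ fixer U, ∀ w, ℓ (ϖ q w) = ℓ w) : ℓ = 0 := by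
  refine LinearMap.ext fun w => ?_
  have h1 : ℓ (eigenProj ϖ (fixer U) 1 w) = ℓ w := functional_eigenProj (fun q w => by
    rw [hℓ q q.2, MonoidHom.one_apply, one_mul]) w
  have h3 := eigenProj_fixer_mem (ϖ := ϖ) (U := U) w
  rw [hU, Submodule.mem_bot] at h3
  rw [← h1, h3, map_zero, LinearMap.zero_apply]

theorem classSym_of_fixInv_eq_bot [Finite F] [FiniteDimensional F V] [FiniteDimensional ℂ W]
    (h2 : (2 : F) ≠ 0) (hϖ : Good ϖ)
    (hirr : ∀ K : Submodule ℂ W, (∀ g, ∀ w ∈ K, ϖ g w ∈ K) → K = ⊥ ∨ K = ⊤)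
    (hbot : ∀ U : Submodule F V, IsHyp U → fixInv ϖ U = ⊥) {w : W} (hw : w ≠ 0) : ClassSym ϖ := by
  obtain ⟨ℓ, hℓw, hℓ⟩ := hϖ w hw
  have hℓ0 : ℓ ≠ 0 := fun h0 => hℓw (by rw [h0, LinearMap.zero_apply])
  cases hℓ with
  | step _ U hU JU hJU _ h =>
    exact absurd (functional_eq_zero_of_fixInv_eq_bot (hbot U hU) fun q hq =>
      h q 1 hJU.one_mem fun u => hq u u.2) hℓ0
  | base _ A hA _ h =>
    obtain ⟨ψ, hψ⟩ : ∃ ψ : AddChar F ℂ, ψ 1 ≠ 1 := AddChar.exists_apply_ne_zero.2 one_ne_zero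
    let p : Module.End F V := (2 : F)⁻¹ • (1 + A)
    have hA' : A * A = 1 := LinearMap.ext hA
    have hp : p * p = p := by
      have h1 : (1 + A) * (1 + A) = (2 : F) • (1 + A : Module.End F V) := by
        rw [two_smul]
        calc (1 + A) * (1 + A) = 1 + A + A + A * A := by noncomm_ring
          _ = _ := by rw [hA']; abel
      simp only [p]
      rw [smul_mul_smul_comm, h1, smul_smul, mul_assoc, inv_mul_cancel₀ h2, mul_one]
    have hpA : A = (2 : F) • p - 1 := by
      simp only [p]
      rw [smul_smul, mul_inv_cancel₀ h2, one_smul, add_sub_cancel_left]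
    obtain ⟨ν, k, h1, h3, h4, h5, ℓ', hℓ', hz, hm⟩ := exists_homotopy_functional ⟨1, hψ⟩ hp hℓ0
      (fun g hg => h g fun v => by
        have h6 : g * A = A * (g : Module.End F V) := by
          rw [hpA, mul_sub, sub_mul, mul_smul_comm, smul_mul_assoc, hg, mul_one, one_mul]
        exact LinearMap.congr_fun h6 v)
      (fun U hU ℓ hℓ => functional_eq_zero_of_fixInv_eq_bot (hbot U hU) hℓ)
    have hs : IsSwap p ν k := ⟨hp, h1, h3, h4, h5⟩
    exact hs.classSym h2 ⟨1, hψ⟩ hirr hℓ' (hs.functional_eigen hz hm)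

theorem ClassSymAll.of_traceSymAll [Finite F] [FiniteDimensional F V] (h2 : (2 : F) ≠ 0)
    (h : TraceSymAll F V) :
    ClassSymAll F V := by
  suffices H : ∀ (N : ℕ) (W : Type) [AddCommGroup W] [Module ℂ W] [FiniteDimensional ℂ W]
      (ϖ : Representation ℂ (V ≃ₗ[F] V) W), Module.finrank ℂ W = N → Good ϖ → ClassSym ϖ from
    fun W _ _ _ ϖ hϖ => H _ W ϖ rfl hϖ
  intro N
  induction N using Nat.strong_induction_on with
  | _ N ih =>
    intro W _ _ _ ϖ hN hϖ
    by_cases hirr : ∀ K : Submodule ℂ W, (∀ g, ∀ w ∈ K, ϖ g w ∈ K) → K = ⊥ ∨ K = ⊤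
    · by_cases hbot : ∀ U : Submodule F V, IsHyp U → fixInv ϖ U = ⊥
      · by_cases hw : ∃ w : W, w ≠ 0
        · exact classSym_of_fixInv_eq_bot h2 hϖ hirr hbot hw.choose_spec
        · push Not at hw
          exact fun s => LinearMap.ext fun w => by rw [hw w, map_zero, map_zero]
      · push Not at hbot
        obtain ⟨U, hU, hne⟩ := hbot
        exact classSym_of_fixInv_ne_bot h hϖ hirr hU hne
    · push Not at hirr
      obtain ⟨K, hK, hKbot, hKtop⟩ := hirr
      exact ClassSym.of_subRep K hK hKbot hKtop fun K hK hlt =>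
        ih _ (hN ▸ hlt) K _ rfl (good_subRep hϖ K hK)

theorem classSymAll [Finite F] [FiniteDimensional F V] (h2 : (2 : F) ≠ 0) :
    ClassSymAll F V := by
  suffices H : ∀ (N : ℕ) (V : Type) [AddCommGroup V] [Module F V] [FiniteDimensional F V]
      [Finite V], Module.finrank F V = N → ClassSymAll F V ∧ TraceSymAll F V from (H _ V rfl).1
  intro N
  induction N using Nat.strong_induction_on with
  | _ N ih =>
    intro V _ _ _ _ hN
    have h := TraceSymAll.of_hyp (V := V) h2 fun U hU => ih _ (hN ▸ hU.finrank_lt) U rfl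
    exact ⟨ClassSymAll.of_traceSymAll h2 h, h⟩

end Induction

section SelfDuality

theorem good_of_functional {F V W : Type} [Field F] [AddCommGroup V] [Module F V]
    [AddCommGroup W] [Module ℂ W] {ϖ : Representation ℂ (V ≃ₗ[F] V) W}
    (hirr : ∀ K : Submodule ℂ W, (∀ g, ∀ w ∈ K, ϖ g w ∈ K) → K = ⊥ ∨ K = ⊤) {A : V ≃ₗ[F] V}
    (hA : A * A = 1) {ℓ : Module.Dual ℂ W} (hℓ0 : ℓ ≠ 0)
    (hℓ : ∀ g, g * A = A * g → ∀ w, ℓ (ϖ g w) = ℓ w) : Good ϖ := by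
  intro w hw
  let N : Submodule ℂ W := ⨅ g, LinearMap.ker (ℓ ∘ₗ ϖ g)
  have hN : ∀ x, x ∈ N ↔ ∀ g, ℓ (ϖ g x) = 0 := fun x => by
    simp [N, Submodule.mem_iInf]
  have hNst : ∀ g, ∀ x ∈ N, ϖ g x ∈ N := fun g x hx => by
    rw [hN] at hx ⊢
    intro y
    rw [← rep_mul]
    exact hx _
  have hbot : N = ⊥ := (hirr N hNst).resolve_right fun htop => hℓ0 (LinearMap.ext fun x => by
    simpa using (hN x).1 (htop ▸ Submodule.mem_top) 1)
  obtain ⟨g, hg⟩ : ∃ g, ℓ (ϖ g w) ≠ 0 := by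
    by_contra! h
    exact hw ((Submodule.mem_bot ℂ).1 (hbot ▸ (hN w).2 h))
  have hA' : (g⁻¹ * A * g) * (g⁻¹ * A * g) = 1 := by
    calc (g⁻¹ * A * g) * (g⁻¹ * A * g) = g⁻¹ * (A * A) * g := by group
      _ = 1 := by rw [hA]; group
  refine ⟨ℓ ∘ₗ ϖ g, hg, Flagged.base V (g⁻¹ * A * g : V ≃ₗ[F] V)
    (fun v => LinearEquiv.congr_fun hA' v) _ fun x hx y => ?_⟩
  have hx' : x * (g⁻¹ * A * g) = g⁻¹ * A * g * x := LinearEquiv.ext hx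
  have hgx : g * x * g⁻¹ * A = A * (g * x * g⁻¹) := by
    calc g * x * g⁻¹ * A = g * (x * (g⁻¹ * A * g)) * g⁻¹ := by group
      _ = _ := by rw [hx']; group
  change ℓ (ϖ g (ϖ x y)) = ℓ (ϖ g y)
  rw [← rep_mul, ← hℓ _ hgx (ϖ g y), ← rep_mul, inv_mul_cancel_right]

theorem IsIrred.repIso_dual {G V : Type} [Group G] [Fintype G] [AddCommGroup V] [Module ℂ V]
    [FiniteDimensional ℂ V] {π : Representation ℂ G V} (hirr : IsIrred π)
    (h : ∀ g, LinearMap.trace ℂ V (π g) = LinearMap.trace ℂ V (π g⁻¹)) : RepIso π π.dual := by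
  have hc : (Fintype.card G : ℂ) ≠ 0 := Nat.cast_ne_zero.2 Fintype.card_ne_zero
  have : Invertible (Nat.card G : ℂ) := invertibleOfNonzero (by rwa [Nat.card_eq_fintype_card])
  have h1 := Representation.card_inv_mul_sum_char_mul_char_eq_finrank (ρ := π) (σ := π)
  have h2 := Representation.card_inv_mul_sum_char_mul_char_eq_finrank (ρ := π) (σ := π.dual)
  have h3 : ∀ g, π.dual.character g = π.character g := fun g => by
    rw [Representation.char_dual]
    exact (h g).symm
  simp only [h3] at h2
  rw [h1, Nat.cast_inj] at h2
  obtain ⟨v, hv⟩ := hirr.1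
  have hnt : Nontrivial (Representation.IntertwiningMap π π) :=
    ⟨Representation.IntertwiningMap.id π, 0, fun h0 => hv (by
      simpa using congrArg (fun f : Representation.IntertwiningMap π π => f v) h0)⟩
  have : Nontrivial (Representation.IntertwiningMap π π.dual) := by
    refine Module.nontrivial_of_finrank_pos (R := ℂ) ?_
    rw [← h2]
    exact Module.finrank_pos
  obtain ⟨f, hf⟩ := exists_ne (0 : Representation.IntertwiningMap π π.dual)
  have hfg : ∀ g v, f (π g v) = π.dual g (f v) := fun g => LinearMap.congr_fun (f.2 g)
  have hker : LinearMap.ker f.toLinearMap = ⊥ := by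
    refine (hirr.2 _ fun g v hv => ?_).resolve_right fun htop => hf ?_
    · have hv' : f v = 0 := hv
      change f (π g v) = 0
      rw [hfg, hv', map_zero]
    · refine Representation.IntertwiningMap.ext (LinearMap.ext fun v => ?_)
      exact LinearMap.mem_ker.1 (htop ▸ Submodule.mem_top : v ∈ LinearMap.ker f.toLinearMap)
  exact ⟨LinearEquiv.ofInjectiveOfFinrankEq f.toLinearMap (LinearMap.ker_eq_bot.1 hker)
    Subspace.dual_finrank_eq.symm, hfg⟩

theorem HasInvVec.exists_functional {G V : Type} [Group G] [Finite G] [AddCommGroup V] [Module ℂ V]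
    {π : Representation ℂ G V} {H : Subgroup G} (h : HasInvVec π (H : Set G)) :
    ∃ ℓ : Module.Dual ℂ V, ℓ ≠ 0 ∧ ∀ g ∈ H, ∀ v, ℓ (π g v) = ℓ v := by
  obtain ⟨v, hv, hvH⟩ := h
  obtain ⟨f, hf⟩ : ∃ f : Module.Dual ℂ V, f v ≠ 0 := by
    by_contra! h0
    exact hv ((Module.forall_dual_apply_eq_zero_iff ℂ v).1 h0)
  refine ⟨f ∘ₗ eigenProj π H 1, fun h0 => hf ?_, fun g hg w => ?_⟩
  · have h1 : eigenProj π H 1 v = v :=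
      eigenProj_apply_of_eigen fun k => (hvH k k.2).trans (one_smul ℂ v).symm
    have h2 := LinearMap.congr_fun h0 v
    rwa [LinearMap.comp_apply, h1] at h2
  · have h1 : eigenProj π H 1 * π g = eigenProj π H 1 := by
      simpa using eigenProj_mul (ϖ := π) (χ := 1) (⟨g, hg⟩ : H)
    exact congrArg f (LinearMap.congr_fun h1 w)

end SelfDuality

/-- **Main Theorem.** Let `q` be an odd prime power, `G = GL_n(𝔽_q)`, and `A ∈ G` with
`A² = I`. Let `H = {X ∈ G : A X A⁻¹ = X}` be the centralizer of `A`. If `π` is an irreducible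
finite-dimensional complex representation of `G` with a nonzero `H`-invariant vector, then
`π ≅ π*`. -/
theorem statement0 (q : ℕ) (hq : IsPrimePow q) (hqodd : Odd q)
    (F : Type) [Field F] [Fintype F] (hF : Fintype.card F = q)
    (n : ℕ) (A : GL (Fin n) F) (hA : A ^ 2 = 1)
    (V : Type) [AddCommGroup V] [Module ℂ V] [FiniteDimensional ℂ V]
    (π : Representation ℂ (GL (Fin n) F) V) (hirr : IsIrred π)
    (hdist : HasInvVec π (Subgroup.centralizer {A} : Set (GL (Fin n) F))) :
    RepIso π π.dual := by
  have h2 : (2 : F) ≠ 0 := Ring.two_ne_zero fun h => by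
    have := FiniteField.even_card_of_char_two h
    rw [hF] at this
    exact (Nat.not_even_iff_odd.2 hqodd) (Nat.even_iff.2 this)
  have := Fintype.ofFinite (GL (Fin n) F)
  let φ : GL (Fin n) F ≃* ((Fin n → F) ≃ₗ[F] (Fin n → F)) :=
    Matrix.GeneralLinearGroup.toLin.trans (LinearMap.GeneralLinearGroup.generalLinearEquiv F _)
  let ϖ : Representation ℂ ((Fin n → F) ≃ₗ[F] (Fin n → F)) V := π.comp φ.symm.toMonoidHom
  have hϖ : ∀ g, ϖ (φ g) = π g := fun g => congrArg π (φ.symm_apply_apply g)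
  obtain ⟨ℓ, hℓ0, hℓ⟩ := hdist.exists_functional
  have hgood : Good ϖ := by
    refine good_of_functional (A := φ A) (fun K hK => hirr.2 K fun g w hw => ?_) ?_ hℓ0
      fun g hg w => ?_
    · rw [← hϖ]
      exact hK _ w hw
    · rw [← map_mul φ, ← pow_two, hA, map_one]
    · obtain ⟨x, rfl⟩ := φ.surjective g
      rw [hϖ]
      refine hℓ x (Subgroup.mem_centralizer_singleton_iff.2 (φ.injective ?_)) w
      rw [map_mul φ, map_mul φ, hg]
  refine hirr.repIso_dual fun g => ?_
  have h3 := (classSymAll h2 V ϖ hgood).trace_eq (η := 1) (fun g => by rw [mul_one, one_mul]) (φ g)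
  rwa [← map_inv, mul_one, mul_one, hϖ, hϖ] at h3

end Paper
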